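/- arXiv:1708.05381 — 2 statements merged into one kernel-verified Lean document; each statement's English description precedes it below -/
import Mathlib

section
/- Triangular slit-plane Green's function: there exists exactly one bounded function h : ℤ² → ℝ with h ≥ 0 such that h = 0 on R, h(v) → 0 as |v| → ∞, and for every v ∉ R, 6·h(v) − ∑_{v' adjacent to v} h(v') equals 1 if v = (0,0) and 0 otherwise. Moreover, for every real t with 0 ≤ t < 1, ∑_{x=0}^∞ h((x,0))·t^x = (2−√3)/√((1−t)·(1−(7−4√3)·t)). In particular h((0,0)) = 2 − √3 and h((1,0)) = 14 − 8√3. -/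
/-- `h` is the Green's function of the triangular lattice (vertex set `ℤ²`, with
`(x,y)` adjacent to `(x±1,y)`, `(x,y±1)`, `(x+1,y+1)`, `(x-1,y-1)`) with Dirichlet
boundary on the ray `R = {(k,0) : k ≤ -1}` and source at the origin: `h` is bounded,
nonnegative, vanishes on `R`, tends to `0` at infinity, and
`6·h(v) - ∑_{v' ~ v} h(v')` is `1` at the origin and `0` at every other vertex
off `R`. -/
def IsTriSlitGreen (h : ℤ × ℤ → ℝ) : Prop :=
  (∃ C : ℝ, ∀ v : ℤ × ℤ, |h v| ≤ C) ∧
  (∀ v : ℤ × ℤ, 0 ≤ h v) ∧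
  (∀ v : ℤ × ℤ, (v.2 = 0 ∧ v.1 ≤ -1) → h v = 0) ∧
  Filter.Tendsto h Filter.cofinite (nhds 0) ∧
  (∀ v : ℤ × ℤ, ¬(v.2 = 0 ∧ v.1 ≤ -1) →
    6 * h v -
      (h (v.1 + 1, v.2) + h (v.1 - 1, v.2) + h (v.1, v.2 + 1) + h (v.1, v.2 - 1) +
        h (v.1 + 1, v.2 + 1) + h (v.1 - 1, v.2 - 1)) =
      if v = (0, 0) then 1 else 0)

open MeasureTheory

namespace TriSlit

/-- Minimum principle. -/
theorem nonneg_of_superharmonic {d : ℤ × ℤ → ℝ}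
    (hd : Filter.Tendsto d Filter.cofinite (nhds 0))
    (hR : ∀ v : ℤ × ℤ, (v.2 = 0 ∧ v.1 ≤ -1) → 0 ≤ d v)
    (hsup : ∀ v : ℤ × ℤ, ¬(v.2 = 0 ∧ v.1 ≤ -1) →
      0 ≤ 6 * d v -
      (d (v.1 + 1, v.2) + d (v.1 - 1, v.2) + d (v.1, v.2 + 1) + d (v.1, v.2 - 1) +
        d (v.1 + 1, v.2 + 1) + d (v.1 - 1, v.2 - 1))) (v : ℤ × ℤ) : 0 ≤ d v := by
  by_contra! hv
  have fin : ∀ c < 0, {w | d w ≤ c}.Finite := by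
    intro c hc
    have := hd.eventually (lt_mem_nhds hc)
    rw [Filter.eventually_cofinite] at this
    simpa only [not_lt] using this
  obtain ⟨m, hm, hmin⟩ := Set.exists_min_image _ d (fin _ hv) ⟨v, le_refl (d v)⟩
  have hm' : d m ≤ d v := hm
  have hmin' : ∀ w, d m ≤ d w := fun w => by
    by_cases hw : d w ≤ d v
    · exact hmin w hw
    · linarith
  have key : ∀ n : ℕ, d (m.1 + n, m.2) = d m := by
    intro n
    induction n with
    | zero => simp
    | succ n ih =>
      have hnR : ¬((m.1 + (n : ℤ), m.2).2 = 0 ∧ (m.1 + (n : ℤ), m.2).1 ≤ -1) := by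
        intro h
        have := hR _ h
        linarith
      have h := hsup _ hnR
      simp only [ih] at h
      have h1 := hmin' (m.1 + n - 1, m.2)
      have h2 := hmin' (m.1 + n, m.2 + 1)
      have h3 := hmin' (m.1 + n, m.2 - 1)
      have h4 := hmin' (m.1 + n + 1, m.2 + 1)
      have h5 := hmin' (m.1 + n - 1, m.2 - 1)
      have h6 := hmin' (m.1 + n + 1, m.2)
      push_cast
      rw [← add_assoc]
      linarith
  refine Set.infinite_of_injective_forall_mem (f := fun n : ℕ => (m.1 + (n : ℤ), m.2)) ?_ ?_
    (fin _ hv)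
  · intro a b hab
    simpa using hab
  · intro n
    simp only [Set.mem_ofPred_eq, key n]
    exact hm'

theorem isTriSlitGreen_unique {h h' : ℤ × ℤ → ℝ} (H : IsTriSlitGreen h)
    (H' : IsTriSlitGreen h') : h = h' := by
  have aux : ∀ h h' : ℤ × ℤ → ℝ, IsTriSlitGreen h → IsTriSlitGreen h' → ∀ v, h v ≤ h' v := by
    intro h h' H H' v
    have := nonneg_of_superharmonic (d := fun v => h' v - h v)
      (by simpa using H'.2.2.2.1.sub H.2.2.2.1)
      (fun v hv => by simp [H.2.2.1 v hv, H'.2.2.1 v hv])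
      (fun v hv => by
        have e1 := H.2.2.2.2 v hv
        have e2 := H'.2.2.2.2 v hv
        linarith) v
    linarith
  funext v
  exact le_antisymm (aux _ _ H H' v) (aux _ _ H' H v)

/-- Lebesgue measure on one period `(-π, π]`. -/
noncomputable def period : Measure ℝ := volume.restrict (Set.Ioc (-Real.pi) Real.pi)

/-- The point of the unit circle with argument `θ`. -/
noncomputable def ee (θ : ℝ) : ℂ := Complex.exp (θ * Complex.I)

/-- The `n`-th Fourier coefficient on one period. -/
noncomputable def coef (f : ℝ → ℂ) (n : ℤ) : ℂ :=
  (1 / (2 * Real.pi) : ℂ) * ∫ θ, f θ * ee θ ^ (-n) ∂period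

theorem ee_ne_zero (θ : ℝ) : ee θ ≠ 0 := Complex.exp_ne_zero _

theorem norm_ee (θ : ℝ) : ‖ee θ‖ = 1 := Complex.norm_exp_ofReal_mul_I θ

theorem continuous_ee : Continuous ee := by unfold ee; fun_prop

theorem continuous_ee_zpow (n : ℤ) : Continuous fun θ => ee θ ^ n :=
  continuous_ee.zpow₀ n fun θ => Or.inl (ee_ne_zero θ)

theorem norm_ee_zpow (n : ℤ) (θ : ℝ) : ‖ee θ ^ n‖ = 1 := by simp [norm_ee]

theorem ee_zpow (n : ℤ) (θ : ℝ) : ee θ ^ n = Complex.exp (n * (θ * Complex.I)) := by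
  rw [ee, ← Complex.exp_int_mul]

instance : IsFiniteMeasure period := by unfold period; infer_instance

theorem integral_ee_zpow (n : ℤ) :
    ∫ θ, ee θ ^ n ∂period = if n = 0 then (2 * Real.pi : ℂ) else 0 := by
  have hle : -Real.pi ≤ Real.pi := by linarith [Real.pi_pos]
  split_ifs with hn
  · subst hn
    simp [period, integral_const, Real.pi_pos.le]
    ring
  · have : ∀ θ : ℝ, ee θ ^ n = Complex.exp ((n * Complex.I) * θ) := fun θ => by
      rw [ee_zpow]; congr 1; ring
    simp only [this, period]
    rw [← intervalIntegral.integral_of_le hle,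
      integral_exp_mul_complex (by simp [hn])]
    have : Complex.exp (n * Complex.I * (Real.pi : ℝ)) =
        Complex.exp (n * Complex.I * ((-Real.pi : ℝ) : ℂ)) := by
      rw [Complex.exp_eq_exp_iff_exists_int]
      exact ⟨n, by push_cast; ring⟩
    rw [this, sub_self, zero_div]

theorem integrable_mul_ee_zpow {f : ℝ → ℂ} (hf : Integrable f period) (n : ℤ) :
    Integrable (fun θ => f θ * ee θ ^ n) period := by
  refine hf.mul_bdd (c := 1) (continuous_ee_zpow n).aestronglyMeasurable ?_
  exact Filter.Eventually.of_forall fun θ => (norm_ee_zpow n θ).le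

theorem coef_eq_of_hasSum {f : ℝ → ℂ} {c : ℕ → ℂ} (hc : Summable fun m => ‖c m‖)
    (hf : ∀ θ, HasSum (fun m : ℕ => c m * ee θ ^ m) (f θ)) (n : ℤ) :
    coef f n = if 0 ≤ n then c n.toNat else 0 := by
  have hsum : HasSum (fun m : ℕ => ∫ θ, (c m * ee θ ^ m) * ee θ ^ (-n) ∂period)
      (∫ θ, ∑' m : ℕ, (c m * ee θ ^ m) * ee θ ^ (-n) ∂period) := by
    refine hasSum_integral_of_summable_integral_norm ?_ ?_
    · intro m
      refine integrable_mul_ee_zpow ?_ _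
      refine Integrable.of_bound (C := ‖c m‖) (by
        have := continuous_ee
        exact Continuous.aestronglyMeasurable (by fun_prop)) ?_
      exact Filter.Eventually.of_forall fun θ => by simp [norm_ee]
    · simp only [norm_mul, norm_pow, norm_ee, one_pow, mul_one, norm_ee_zpow, integral_const,
        smul_eq_mul]
      exact hc.mul_left _
  have e1 : ∀ θ, ∑' m : ℕ, (c m * ee θ ^ m) * ee θ ^ (-n) = f θ * ee θ ^ (-n) :=
    fun θ => ((hf θ).mul_right _).tsum_eq
  have e2 : ∀ m : ℕ, ∫ θ, (c m * ee θ ^ m) * ee θ ^ (-n) ∂period =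
      if (m : ℤ) = n then 2 * Real.pi * c m else 0 := by
    intro m
    have : ∀ θ, (c m * ee θ ^ m) * ee θ ^ (-n) = c m * ee θ ^ ((m : ℤ) - n) := fun θ => by
      rw [mul_assoc, ← zpow_natCast, ← zpow_add₀ (ee_ne_zero θ), sub_eq_add_neg]
    simp only [this]
    rw [integral_const_mul, integral_ee_zpow]
    simp only [sub_eq_zero]
    split_ifs <;> ring
  simp only [e1, e2] at hsum
  have hpi : (Real.pi : ℂ) ≠ 0 := by exact_mod_cast Real.pi_ne_zero
  rw [coef]
  split_ifs with hn
  · lift n to ℕ using hn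
    have h2 : HasSum (fun m : ℕ => if (m : ℤ) = n then 2 * Real.pi * c m else 0)
        (2 * Real.pi * c n) := by
      convert hasSum_ite_eq (n : ℕ) (2 * Real.pi * c n) using 2 with m
      simp only [Nat.cast_inj]
      split_ifs with h
      · rw [h]
      · rfl
    rw [hsum.unique h2]
    simp only [Int.toNat_natCast]
    field_simp
  · have h2 : HasSum (fun m : ℕ => if (m : ℤ) = n then 2 * Real.pi * c m else 0) 0 := by
      convert hasSum_zero using 2 with m
      rw [if_neg]
      omega
    rw [hsum.unique h2, mul_zero]

/-- Fourier coefficients of the radial boundary values of a function analytic in the unit disc. -/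
theorem coef_boundary {Φ : ℂ → ℂ} {c : ℕ → ℂ}
    (hΦ : ∀ z : ℂ, ‖z‖ < 1 → HasSum (fun m : ℕ => c m * z ^ m) (Φ z))
    (hmeas : Measurable Φ) {g : ℝ → ℝ} (hg : Integrable g period)
    (hbound : ∀ r : ℝ, 0 < r → r < 1 → ∀ᵐ θ ∂period, ‖Φ (r * ee θ)‖ ≤ g θ)
    (hcont : ∀ᵐ θ ∂period, ContinuousAt Φ (ee θ)) (n : ℤ) :
    coef (fun θ => Φ (ee θ)) n = if 0 ≤ n then c n.toNat else 0 := by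
  have hev : ∀ᶠ r : ℝ in nhdsWithin 1 (Set.Iio 1), 0 < r ∧ r < 1 := by
    filter_upwards [Ioo_mem_nhdsLT (zero_lt_one' ℝ)] with r hr using hr
  have h1 : ∀ r : ℝ, 0 < r → r < 1 → coef (fun θ => Φ (r * ee θ)) n =
      (if 0 ≤ n then c n.toNat * r ^ n.toNat else 0) := by
    intro r hr0 hr1
    have hn : ∀ θ, ‖(r : ℂ) * ee θ‖ < 1 := fun θ => by
      simp [norm_ee, abs_of_pos hr0, hr1]
    rw [coef_eq_of_hasSum (c := fun m => c m * r ^ m)]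
    · have := (hΦ r (by simp [abs_of_pos hr0, hr1])).summable
      exact this.norm
    · intro θ
      simpa only [mul_pow, mul_assoc] using hΦ _ (hn θ)
  have hlim : Filter.Tendsto (fun r : ℝ => coef (fun θ => Φ (r * ee θ)) n)
      (nhdsWithin 1 (Set.Iio 1)) (nhds (coef (fun θ => Φ (ee θ)) n)) := by
    unfold coef
    refine Filter.Tendsto.const_mul _ ?_
    refine tendsto_integral_filter_of_dominated_convergence g ?_ ?_ hg ?_
    · refine Filter.Eventually.of_forall fun r => Measurable.aestronglyMeasurable ?_
      have := continuous_ee.measurable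
      have := (continuous_ee_zpow (-n)).measurable
      fun_prop
    · filter_upwards [hev] with r hr
      filter_upwards [hbound r hr.1 hr.2] with θ hθ
      rwa [norm_mul, norm_ee_zpow, mul_one]
    · filter_upwards [hcont] with θ hθ
      refine Filter.Tendsto.mul_const _ ?_
      refine hθ.tendsto.comp ?_
      have : Continuous fun r : ℝ => (r : ℂ) * ee θ := by fun_prop
      have := this.tendsto 1
      simp only [Complex.ofReal_one, one_mul] at this
      exact this.mono_left nhdsWithin_le_nhds
  have hlim2 : Filter.Tendsto (fun r : ℝ => coef (fun θ => Φ (r * ee θ)) n)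
      (nhdsWithin 1 (Set.Iio 1)) (nhds (if 0 ≤ n then c n.toNat else 0)) := by
    refine Filter.Tendsto.congr' (f₁ := fun r : ℝ =>
      (if 0 ≤ n then c n.toNat * (r : ℂ) ^ n.toNat else 0)) ?_ ?_
    · filter_upwards [hev] with r hr using (h1 r hr.1 hr.2).symm
    · have : Continuous fun r : ℝ => (if 0 ≤ n then c n.toNat * (r : ℂ) ^ n.toNat else 0) := by
        split_ifs <;> fun_prop
      have := this.tendsto 1
      simp only [Complex.ofReal_one, one_pow, mul_one] at this
      exact this.mono_left nhdsWithin_le_nhds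
  exact tendsto_nhds_unique hlim hlim2

theorem tendsto_coef (f : ℝ → ℂ) :
    Filter.Tendsto (coef f) Filter.cofinite (nhds 0) := by
  have hpi : (2 * Real.pi)⁻¹ ≠ 0 := by positivity
  have h := (Real.tendsto_integral_exp_smul_cocompact
    (Set.indicator (Set.Ioc (-Real.pi) Real.pi) f)).comp
    ((Homeomorph.mulRight₀ _ hpi).isClosedEmbedding.tendsto_cocompact.comp
      Int.tendsto_coe_cofinite)
  have h2 := h.const_mul (1 / (2 * Real.pi) : ℂ)
  rw [mul_zero] at h2
  refine h2.congr fun n => ?_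
  simp only [coef, period, Function.comp]
  rw [← integral_indicator measurableSet_Ioc]
  congr 2
  funext θ
  by_cases hθ : θ ∈ Set.Ioc (-Real.pi) Real.pi
  · simp only [Set.indicator_of_mem hθ, Circle.smul_def, Real.fourierChar_apply, smul_eq_mul,
      ee_zpow, Homeomorph.coe_mulRight₀]
    rw [mul_comm]
    congr 2
    have : (Real.pi : ℂ) ≠ 0 := by exact_mod_cast Real.pi_ne_zero
    push_cast
    field_simp
  · simp [Set.indicator_of_notMem hθ]

theorem norm_coef_le (f : ℝ → ℂ) (n : ℤ) :
    ‖coef f n‖ ≤ (1 / (2 * Real.pi)) * ∫ θ, ‖f θ‖ ∂period := by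
  rw [coef, norm_mul]
  have : ‖(1 / (2 * Real.pi) : ℂ)‖ = 1 / (2 * Real.pi) := by
    simp [abs_of_pos Real.pi_pos]
  rw [this]
  gcongr
  refine (norm_integral_le_integral_norm _).trans_eq ?_
  simp only [norm_mul, norm_ee_zpow, mul_one]

theorem ae_period : ∀ᵐ θ ∂period, |θ| ≤ Real.pi ∧ θ ≠ 0 := by
  refine Filter.Eventually.and ?_ ?_
  · filter_upwards [ae_restrict_mem measurableSet_Ioc] with θ hθ
    exact abs_le.2 ⟨hθ.1.le, hθ.2⟩
  · exact ae_restrict_of_ae (Measure.ae_ne volume 0)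

theorem integrable_abs_rpow : Integrable (fun θ : ℝ => |θ| ^ (-(1 / 2) : ℝ)) period := by
  have hle : -Real.pi ≤ Real.pi := by linarith [Real.pi_pos]
  change IntegrableOn _ _ _
  rw [← intervalIntegrable_iff_integrableOn_Ioc_of_le hle]
  have h0 : IntervalIntegrable (fun θ : ℝ => |θ| ^ (-(1 / 2) : ℝ)) volume 0 Real.pi := by
    refine (intervalIntegral.intervalIntegrable_rpow' (r := -(1 / 2)) (by norm_num)).congr ?_
    intro θ hθ
    rw [Set.uIoc_of_le Real.pi_pos.le] at hθ
    simp only [abs_of_pos hθ.1]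
  have h1 : IntervalIntegrable (fun θ : ℝ => |θ| ^ (-(1 / 2) : ℝ)) volume (-Real.pi) 0 := by
    have h := (IntervalIntegrable.iff_comp_neg (a := 0) (b := Real.pi)
      (f := fun θ : ℝ => |θ| ^ (-(1 / 2) : ℝ)) (by simp)).1 h0
    simpa using h.symm
  exact h1.trans h0

/-- The constant `2 - √3`, whose square is `7 - 4√3`. -/
noncomputable def sg : ℝ := 2 - Real.sqrt 3

theorem sg_pos : 0 < sg := by
  have : Real.sqrt 3 < 2 := by rw [Real.sqrt_lt' (by norm_num)]; norm_num
  unfold sg; linarith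

theorem sg_lt_one : sg < 1 := by
  have : 1 < Real.sqrt 3 := by rw [Real.lt_sqrt (by norm_num)]; norm_num
  unfold sg; linarith

theorem sg_sq : sg ^ 2 = 4 * sg - 1 := by
  have := Real.sq_sqrt (show (0 : ℝ) ≤ 3 by norm_num)
  unfold sg; linear_combination this

theorem sg_sq_eq : sg ^ 2 = 7 - 4 * Real.sqrt 3 := by
  rw [sg_sq, sg]; ring

theorem sg_sq_lt_one : sg ^ 2 < 1 := by nlinarith [sg_pos, sg_lt_one]

/-- The branch of `√((1 - z)(1 - σ²z))` analytic in the unit disc. -/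
noncomputable def rootG (z : ℂ) : ℂ :=
  (1 - z) ^ (1 / 2 : ℂ) * (1 - (sg : ℂ) ^ 2 * z) ^ (1 / 2 : ℂ)

/-- The generating function of the Green's function along the positive axis. -/
noncomputable def slitF (z : ℂ) : ℂ := sg / rootG z

theorem cpow_half_sq (z : ℂ) : (z ^ (1 / 2 : ℂ)) ^ 2 = z := by
  simp

theorem rootG_sq (z : ℂ) : rootG z ^ 2 = (1 - z) * (1 - (sg : ℂ) ^ 2 * z) := by
  rw [rootG, mul_pow, cpow_half_sq, cpow_half_sq]

theorem norm_rootG_sq (z : ℂ) : ‖rootG z‖ ^ 2 = ‖1 - z‖ * ‖1 - (sg : ℂ) ^ 2 * z‖ := by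
  rw [← norm_pow, rootG_sq, norm_mul]

theorem measurable_rootG : Measurable rootG := by unfold rootG; fun_prop

theorem measurable_slitF : Measurable slitF := by
  unfold slitF; exact measurable_rootG.const_div _

theorem one_sub_mem_slitPlane {z : ℂ} (hz : ‖z‖ ≤ 1) (h1 : z ≠ 1) :
    1 - z ∈ Complex.slitPlane := by
  rw [Complex.mem_slitPlane_iff]
  by_contra! h
  obtain ⟨hre, him⟩ := h
  simp only [Complex.sub_re, Complex.one_re, Complex.sub_im, Complex.one_im] at hre him
  have := (Complex.re_le_norm z).trans hz
  exact h1 (Complex.ext (by simp; linarith) (by simp; linarith))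

theorem norm_sg_sq_mul_lt {z : ℂ} (hz : ‖z‖ ≤ 1) : ‖(sg : ℂ) ^ 2 * z‖ ≤ sg ^ 2 := by
  rw [norm_mul, norm_pow, Complex.norm_real, Real.norm_of_nonneg sg_pos.le]
  nlinarith [sq_nonneg sg]

theorem one_sub_sg_mem_slitPlane {z : ℂ} (hz : ‖z‖ ≤ 1) :
    1 - (sg : ℂ) ^ 2 * z ∈ Complex.slitPlane := by
  have h := norm_sg_sq_mul_lt hz
  have := sg_sq_lt_one
  refine one_sub_mem_slitPlane (by linarith) ?_
  intro h1
  rw [h1, norm_one] at h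
  linarith

theorem differentiableAt_rootG {z : ℂ} (hz : ‖z‖ ≤ 1) (h1 : z ≠ 1) :
    DifferentiableAt ℂ rootG z := by
  unfold rootG
  exact (DifferentiableAt.cpow_const (by fun_prop) (one_sub_mem_slitPlane hz h1)).mul
    (DifferentiableAt.cpow_const (by fun_prop) (one_sub_sg_mem_slitPlane hz))

theorem rootG_ne_zero {z : ℂ} (hz : ‖z‖ ≤ 1) (h1 : z ≠ 1) : rootG z ≠ 0 := by
  intro h
  have := rootG_sq z
  rw [h] at this
  have h2 := Complex.slitPlane_ne_zero (one_sub_mem_slitPlane hz h1)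
  have h3 := Complex.slitPlane_ne_zero (one_sub_sg_mem_slitPlane hz)
  simp at this
  tauto

theorem differentiableAt_slitF {z : ℂ} (hz : ‖z‖ ≤ 1) (h1 : z ≠ 1) :
    DifferentiableAt ℂ slitF z := by
  unfold slitF
  exact (differentiableAt_const _).div (differentiableAt_rootG hz h1) (rootG_ne_zero hz h1)

theorem norm_one_sub_ee {θ : ℝ} (hθ : |θ| ≤ Real.pi) :
    2 * (|θ| / Real.pi) ≤ ‖1 - ee θ‖ := by
  have h1 : ‖1 - ee θ‖ = 2 * |Real.sin (θ / 2)| := by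
    rw [norm_sub_rev, ee, mul_comm, Complex.norm_exp_I_mul_ofReal_sub_one]
    simp
  have h2 : |Real.sin (θ / 2)| = Real.sin (|θ| / 2) := by
    have h3 : 0 ≤ Real.sin (|θ| / 2) :=
      Real.sin_nonneg_of_nonneg_of_le_pi (by positivity) (by linarith [abs_nonneg θ])
    rcases abs_cases θ with h | h
    · rw [h.1] at h3 ⊢; exact abs_of_nonneg h3
    · rw [h.1, neg_div, Real.sin_neg] at h3 ⊢; exact abs_of_nonpos (by linarith)
  have h3 := Real.mul_le_sin (x := |θ| / 2) (by positivity) (by linarith)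
  rw [h1, h2]
  refine le_trans (le_of_eq ?_) (mul_le_mul_of_nonneg_left h3 zero_le_two)
  field_simp

theorem ee_ne_one {θ : ℝ} (hθ : |θ| ≤ Real.pi) (h0 : θ ≠ 0) : ee θ ≠ 1 := by
  intro h
  have := norm_one_sub_ee hθ
  rw [h, sub_self, norm_zero] at this
  have : 0 < 2 * (|θ| / Real.pi) := by positivity
  linarith

theorem norm_one_sub_mul_ee {θ r : ℝ} (hθ : |θ| ≤ Real.pi) (hr0 : 0 ≤ r) (hr1 : r ≤ 1) :
    |θ| / Real.pi ≤ ‖1 - r * ee θ‖ := by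
  have h1 := norm_one_sub_ee hθ
  have hn : ‖(r : ℂ) * ee θ‖ = r := by simp [norm_ee, abs_of_nonneg hr0]
  have h2 : 1 - r ≤ ‖1 - r * ee θ‖ := by
    have := norm_sub_norm_le (1 : ℂ) (r * ee θ)
    rwa [hn, norm_one] at this
  have h3 : ‖1 - ee θ‖ ≤ ‖1 - r * ee θ‖ + (1 - r) := by
    have h4 : 1 - ee θ = (1 - r * ee θ) - ((1 - r : ℝ) : ℂ) * ee θ := by push_cast; ring
    have h5 : ‖((1 - r : ℝ) : ℂ) * ee θ‖ = 1 - r := by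
      rw [norm_mul, norm_ee, mul_one, Complex.norm_real, Real.norm_of_nonneg (by linarith)]
    rw [h4]
    exact (norm_sub_le _ _).trans_eq (by rw [h5])
  linarith

/-- An integrable majorant of the radial values of `slitF`. -/
noncomputable def majorant (θ : ℝ) : ℝ :=
  sg / Real.sqrt ((1 - sg ^ 2) / Real.pi) * |θ| ^ (-(1 / 2) : ℝ)

theorem integrable_majorant : Integrable majorant period := integrable_abs_rpow.const_mul _

theorem norm_slitF_le {θ r : ℝ} (hθ : |θ| ≤ Real.pi) (h0 : θ ≠ 0) (hr0 : 0 ≤ r) (hr1 : r ≤ 1) :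
    ‖slitF (r * ee θ)‖ ≤ majorant θ := by
  have hn : ‖(r : ℂ) * ee θ‖ ≤ 1 := by simp [norm_ee, abs_of_nonneg hr0, hr1]
  have h1 := norm_one_sub_mul_ee hθ hr0 hr1
  have h2 : 1 - sg ^ 2 ≤ ‖1 - (sg : ℂ) ^ 2 * (r * ee θ)‖ := by
    have := norm_sub_norm_le (1 : ℂ) ((sg : ℂ) ^ 2 * (r * ee θ))
    rw [norm_one] at this
    linarith [norm_sg_sq_mul_lt hn]
  have hs := sg_sq_lt_one
  have h3 : Real.sqrt ((1 - sg ^ 2) / Real.pi * |θ|) ≤ ‖rootG (r * ee θ)‖ := by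
    rw [Real.sqrt_le_left (norm_nonneg _), norm_rootG_sq]
    calc (1 - sg ^ 2) / Real.pi * |θ| = |θ| / Real.pi * (1 - sg ^ 2) := by ring
      _ ≤ _ := by
        have : 0 ≤ 1 - sg ^ 2 := by linarith
        gcongr
  have h4 : 0 < (1 - sg ^ 2) / Real.pi := div_pos (by linarith) Real.pi_pos
  rw [slitF, norm_div, Complex.norm_real, Real.norm_of_nonneg sg_pos.le, majorant,
    Real.rpow_neg (abs_nonneg _), ← Real.sqrt_eq_rpow, ← div_eq_mul_inv, div_div,
    ← Real.sqrt_mul h4.le]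
  have : 0 < Real.sqrt ((1 - sg ^ 2) / Real.pi * |θ|) :=
    Real.sqrt_pos.2 (mul_pos h4 (abs_pos.2 h0))
  have := sg_pos
  gcongr

theorem norm_slitF_ee_le : ∀ᵐ θ ∂period, ‖slitF (ee θ)‖ ≤ majorant θ := by
  filter_upwards [ae_period] with θ hθ
  simpa using norm_slitF_le (r := 1) hθ.1 hθ.2 zero_le_one le_rfl

theorem integrable_slitF : Integrable (fun θ => slitF (ee θ)) period :=
  integrable_majorant.mono' (measurable_slitF.comp continuous_ee.measurable).aestronglyMeasurable
    norm_slitF_ee_le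

theorem norm_rootG_le {z : ℂ} (hz : ‖z‖ ≤ 1) : ‖rootG z‖ ≤ 2 := by
  have h1 : ‖1 - z‖ ≤ 2 := (norm_sub_le _ _).trans (by rw [norm_one]; linarith)
  have h2 : ‖1 - (sg : ℂ) ^ 2 * z‖ ≤ 2 := (norm_sub_le _ _).trans (by
    rw [norm_one]; linarith [norm_sg_sq_mul_lt hz, sg_sq_lt_one])
  have h3 := norm_rootG_sq z
  have h4 := mul_le_mul h1 h2 (norm_nonneg _) zero_le_two
  nlinarith [norm_nonneg (rootG z)]

/-- Taylor coefficients at the origin. -/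
noncomputable def taylorCoeff (Φ : ℂ → ℂ) (n : ℕ) : ℂ := (n.factorial : ℂ)⁻¹ * iteratedDeriv n Φ 0

theorem hasSum_taylorCoeff {Φ : ℂ → ℂ} (hΦ : ∀ z : ℂ, ‖z‖ < 1 → DifferentiableAt ℂ Φ z)
    {z : ℂ} (hz : ‖z‖ < 1) : HasSum (fun m : ℕ => taylorCoeff Φ m * z ^ m) (Φ z) := by
  have := Complex.hasSum_taylorSeries_on_ball (f := Φ) (c := 0) (r := 1)
    (fun z hz => (hΦ z (by simpa using hz)).differentiableWithinAt) (z := z) (by simpa using hz)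
  refine this.congr_fun fun m => ?_
  simp only [taylorCoeff, sub_zero, smul_eq_mul]
  ring

theorem ne_one_of_norm_lt {z : ℂ} (hz : ‖z‖ < 1) : z ≠ 1 := by
  rintro rfl; simp at hz

theorem hasSum_slitF {z : ℂ} (hz : ‖z‖ < 1) :
    HasSum (fun m : ℕ => taylorCoeff slitF m * z ^ m) (slitF z) :=
  hasSum_taylorCoeff (fun _ hz => differentiableAt_slitF hz.le (ne_one_of_norm_lt hz)) hz

theorem hasSum_rootG {z : ℂ} (hz : ‖z‖ < 1) :
    HasSum (fun m : ℕ => taylorCoeff rootG m * z ^ m) (rootG z) :=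
  hasSum_taylorCoeff (fun _ hz => differentiableAt_rootG hz.le (ne_one_of_norm_lt hz)) hz

theorem coef_slitF (n : ℤ) :
    coef (fun θ => slitF (ee θ)) n = if 0 ≤ n then taylorCoeff slitF n.toNat else 0 := by
  refine coef_boundary (fun z hz => hasSum_slitF hz) measurable_slitF integrable_majorant ?_ ?_ n
  · intro r hr0 hr1
    filter_upwards [ae_period] with θ hθ using norm_slitF_le hθ.1 hθ.2 hr0.le hr1.le
  · filter_upwards [ae_period] with θ hθ
    exact (differentiableAt_slitF (norm_ee θ).le (ee_ne_one hθ.1 hθ.2)).continuousAt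

theorem coef_rootG (n : ℤ) :
    coef (fun θ => rootG (ee θ)) n = if 0 ≤ n then taylorCoeff rootG n.toNat else 0 := by
  refine coef_boundary (fun z hz => hasSum_rootG hz) measurable_rootG
    (integrable_const (2 : ℝ)) ?_ ?_ n
  · intro r hr0 hr1
    refine Filter.Eventually.of_forall fun θ => norm_rootG_le ?_
    simp [norm_ee, abs_of_pos hr0, hr1.le]
  · filter_upwards [ae_period] with θ hθ
    exact (differentiableAt_rootG (norm_ee θ).le (ee_ne_one hθ.1 hθ.2)).continuousAt

theorem taylorCoeff_zero (Φ : ℂ → ℂ) : taylorCoeff Φ 0 = Φ 0 := by simp [taylorCoeff]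

theorem taylorCoeff_one (Φ : ℂ → ℂ) : taylorCoeff Φ 1 = deriv Φ 0 := by simp [taylorCoeff]

theorem rootG_zero : rootG 0 = 1 := by simp [rootG]

theorem slitF_zero : slitF 0 = sg := by simp [slitF, rootG_zero]

theorem deriv_slitF_zero : deriv slitF 0 = (14 - 8 * Real.sqrt 3 : ℝ) := by
  have h1 : HasDerivAt (fun z : ℂ => (1 - z) ^ (1 / 2 : ℂ)) (-(1 / 2)) 0 := by
    have := ((hasDerivAt_id (0 : ℂ)).const_sub 1).cpow_const (c := 1 / 2) (by simp)
    exact this.congr_deriv (by simp)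
  have h2 : HasDerivAt (fun z : ℂ => (1 - (sg : ℂ) ^ 2 * z) ^ (1 / 2 : ℂ))
      (-(1 / 2) * (sg : ℂ) ^ 2) 0 := by
    have := (((hasDerivAt_id (0 : ℂ)).const_mul ((sg : ℂ) ^ 2)).const_sub 1).cpow_const
      (c := 1 / 2) (by simp)
    exact this.congr_deriv (by simp)
  have h3 : HasDerivAt rootG (-(1 / 2) - 1 / 2 * (sg : ℂ) ^ 2) 0 := by
    exact (h1.mul h2).congr_deriv (by simp; ring)
  have h4 := (hasDerivAt_const (0 : ℂ) (sg : ℂ)).div h3 (by simp [rootG_zero])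
  have h5 : deriv slitF 0 = _ := h4.deriv
  have e1 := sg_sq
  have e2 : sg = 2 - Real.sqrt 3 := rfl
  have e3 : sg * (1 / 2 + 1 / 2 * sg ^ 2) = 14 - 8 * Real.sqrt 3 := by
    linear_combination (sg / 2 + 2) * e1 + 8 * e2
  rw [h5, ← e3, rootG_zero]
  push_cast
  ring

theorem rootG_ofReal {t : ℝ} (ht : t < 1) :
    rootG t = (Real.sqrt ((1 - t) * (1 - sg ^ 2 * t)) : ℝ) := by
  have h1 : 0 ≤ 1 - t := by linarith
  have h2 : 0 ≤ 1 - sg ^ 2 * t := by nlinarith [sg_sq_lt_one]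
  rw [Real.sqrt_mul h1, Real.sqrt_eq_rpow, Real.sqrt_eq_rpow, Complex.ofReal_mul,
    Complex.ofReal_cpow h1, Complex.ofReal_cpow h2, rootG]
  push_cast
  rfl

/-- The symbol of the horizontal part of the Laplacian. -/
noncomputable def rowSym (θ : ℝ) : ℝ := 6 - 2 * Real.cos θ

/-- The symbol of the Laplacian restricted to the axis. -/
noncomputable def axisSym (θ : ℝ) : ℝ := ‖1 - ee θ‖ * ‖1 - (sg : ℂ) ^ 2 * ee θ‖ / sg

/-- The decaying root of the characteristic equation between consecutive rows. -/
noncomputable def lam (θ : ℝ) : ℂ := 2 * (1 + ee θ) / ((rowSym θ + axisSym θ : ℝ) : ℂ)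

/-- The Fourier transform of row `y` of the Green's function. -/
noncomputable def rowF (y : ℤ) (θ : ℝ) : ℂ :=
  slitF (ee θ) * (lam θ ^ y.toNat * (starRingEnd ℂ) (lam θ) ^ (-y).toNat)

theorem conj_ee (θ : ℝ) : (starRingEnd ℂ) (ee θ) = (ee θ)⁻¹ := by
  rw [Complex.inv_def, Complex.normSq_eq_norm_sq, norm_ee]
  simp

theorem ee_add_inv (θ : ℝ) : ee θ + (ee θ)⁻¹ = (2 * Real.cos θ : ℝ) := by
  rw [← conj_ee, Complex.add_conj, ee, Complex.exp_ofReal_mul_I_re]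

theorem norm_one_add_mul_ee_sq (a θ : ℝ) :
    ‖1 + a * ee θ‖ ^ 2 = 1 + a ^ 2 + a * (2 * Real.cos θ) := by
  have h := Complex.mul_conj' (1 + a * ee θ)
  simp only [map_add, map_one, map_mul, Complex.conj_ofReal, conj_ee] at h
  have h2 := ee_add_inv θ
  have h3 := mul_inv_cancel₀ (ee_ne_zero θ)
  have h4 : ((‖1 + a * ee θ‖ ^ 2 : ℝ) : ℂ) = ((1 + a ^ 2 + a * (2 * Real.cos θ) : ℝ) : ℂ) := by
    push_cast at h2 ⊢
    linear_combination -h + a * h2 + (a : ℂ) ^ 2 * h3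
  exact_mod_cast h4

theorem rowSym_pos (θ : ℝ) : 0 < rowSym θ := by
  unfold rowSym; linarith [Real.cos_le_one θ]

theorem axisSym_nonneg (θ : ℝ) : 0 ≤ axisSym θ :=
  div_nonneg (by positivity) sg_pos.le

theorem axisSym_sq (θ : ℝ) : axisSym θ ^ 2 = rowSym θ ^ 2 - 4 * (2 + 2 * Real.cos θ) := by
  have h1 := norm_one_add_mul_ee_sq (-1) θ
  have h2 := norm_one_add_mul_ee_sq (-sg ^ 2) θ
  have e1 : (1 : ℂ) + ((-1 : ℝ) : ℂ) * ee θ = 1 - ee θ := by push_cast; ring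
  have e2 : (1 : ℂ) + ((-sg ^ 2 : ℝ) : ℂ) * ee θ = 1 - (sg : ℂ) ^ 2 * ee θ := by push_cast; ring
  rw [e1] at h1
  rw [e2] at h2
  have hs := sg_sq
  have h3 : 1 + (-sg ^ 2) ^ 2 + -sg ^ 2 * (2 * Real.cos θ) = sg ^ 2 * (14 - 2 * Real.cos θ) := by
    linear_combination (sg ^ 2 + 4 * sg + 1) * hs
  rw [axisSym, div_pow, mul_pow, h1, h2, h3, rowSym]
  have := sg_pos.ne'
  field_simp
  ring

theorem denom_pos (θ : ℝ) : 0 < rowSym θ + axisSym θ :=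
  add_pos_of_pos_of_nonneg (rowSym_pos θ) (axisSym_nonneg θ)

theorem lam_mul (θ : ℝ) : lam θ * (rowSym θ + axisSym θ : ℂ) = 2 * (1 + ee θ) := by
  have : ((rowSym θ + axisSym θ : ℝ) : ℂ) ≠ 0 := by exact_mod_cast (denom_pos θ).ne'
  rw [lam, ← Complex.ofReal_add, div_mul_cancel₀ _ this]

theorem conj_lam_mul (θ : ℝ) :
    (starRingEnd ℂ) (lam θ) * (rowSym θ + axisSym θ : ℂ) = 2 * (1 + (ee θ)⁻¹) := by
  have h := congrArg (starRingEnd ℂ) (lam_mul θ)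
  simpa [conj_ee, Complex.conj_ofNat] using h

theorem axisSym_sq_complex (θ : ℝ) :
    (axisSym θ : ℂ) ^ 2 = (rowSym θ : ℂ) ^ 2 - 4 * ((1 + ee θ) * (1 + (ee θ)⁻¹)) := by
  have h : ((axisSym θ ^ 2 : ℝ) : ℂ) = _ := congrArg Complex.ofReal (axisSym_sq θ)
  have h2 := ee_add_inv θ
  have h3 := mul_inv_cancel₀ (ee_ne_zero θ)
  push_cast at h h2
  linear_combination h + 4 * h2 + 4 * h3

theorem denom_ne_zero (θ : ℝ) : (rowSym θ + axisSym θ : ℂ) ≠ 0 := by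
  exact_mod_cast (denom_pos θ).ne'

theorem rowSym_eq (θ : ℝ) : (rowSym θ : ℂ) = 6 - ee θ - (ee θ)⁻¹ := by
  have h2 := ee_add_inv θ
  rw [rowSym]
  push_cast at h2 ⊢
  linear_combination h2

theorem lam_quadratic (θ : ℝ) :
    rowSym θ * lam θ - (1 + (ee θ)⁻¹) * lam θ ^ 2 - (1 + ee θ) = 0 := by
  refine (mul_eq_zero.1 ?_).resolve_left (pow_ne_zero 2 (denom_ne_zero θ))
  have h1 := lam_mul θ
  have h2 := axisSym_sq_complex θ
  linear_combination (rowSym θ * (rowSym θ + axisSym θ : ℂ)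
    - (1 + (ee θ)⁻¹) * (lam θ * (rowSym θ + axisSym θ : ℂ) + 2 * (1 + ee θ))) * h1
    - (1 + ee θ) * h2

theorem conj_lam_quadratic (θ : ℝ) :
    rowSym θ * (starRingEnd ℂ) (lam θ) - (1 + ee θ) * (starRingEnd ℂ) (lam θ) ^ 2
      - (1 + (ee θ)⁻¹) = 0 := by
  have h := congrArg (starRingEnd ℂ) (lam_quadratic θ)
  simpa [conj_ee] using h

theorem lam_axis (θ : ℝ) :
    rowSym θ - (1 + (ee θ)⁻¹) * lam θ - (1 + ee θ) * (starRingEnd ℂ) (lam θ) = axisSym θ := by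
  have h0 := denom_ne_zero θ
  have h1 := lam_mul θ
  have h3 := conj_lam_mul θ
  have h2 := axisSym_sq_complex θ
  refine mul_right_cancel₀ h0 ?_
  linear_combination -(1 + (ee θ)⁻¹) * h1 - (1 + ee θ) * h3 - h2

theorem axisSym_mul_slitF (θ : ℝ) :
    axisSym θ * slitF (ee θ) = (starRingEnd ℂ) (rootG (ee θ)) := by
  have h1 : (axisSym θ : ℂ) = rootG (ee θ) * (starRingEnd ℂ) (rootG (ee θ)) / sg := by
    rw [Complex.mul_conj', axisSym, ← norm_rootG_sq]
    push_cast
    rfl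
  have hs : (sg : ℂ) ≠ 0 := by exact_mod_cast sg_pos.ne'
  rw [h1, slitF]
  by_cases h : rootG (ee θ) = 0
  · simp [h]
  · field_simp

theorem two_mul_norm_one_add_ee_sq (θ : ℝ) :
    (2 * ‖1 + ee θ‖) ^ 2 = rowSym θ ^ 2 - axisSym θ ^ 2 := by
  have h1 := norm_one_add_mul_ee_sq 1 θ
  simp only [Complex.ofReal_one, one_mul] at h1
  rw [axisSym_sq, mul_pow, h1]
  ring

theorem norm_lam (θ : ℝ) : ‖lam θ‖ = 2 * ‖1 + ee θ‖ / (rowSym θ + axisSym θ) := by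
  rw [lam, norm_div, norm_mul, Complex.norm_real, Real.norm_of_nonneg (denom_pos θ).le]
  simp

theorem two_mul_norm_one_add_ee_le (θ : ℝ) : 2 * ‖1 + ee θ‖ ≤ rowSym θ := by
  refine abs_le_of_sq_le_sq' ?_ (rowSym_pos θ).le |>.2
  rw [two_mul_norm_one_add_ee_sq]
  nlinarith [sq_nonneg (axisSym θ)]

theorem norm_lam_le_one (θ : ℝ) : ‖lam θ‖ ≤ 1 := by
  rw [norm_lam, div_le_one (denom_pos θ)]
  linarith [two_mul_norm_one_add_ee_le θ, axisSym_nonneg θ]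

theorem norm_lam_lt_one {θ : ℝ} (hθ : |θ| ≤ Real.pi) (h0 : θ ≠ 0) : ‖lam θ‖ < 1 := by
  rw [norm_lam, div_lt_one (denom_pos θ)]
  have h1 : 0 < axisSym θ := by
    refine div_pos (mul_pos ?_ ?_) sg_pos
    · exact norm_pos_iff.2 (sub_ne_zero.2 (ee_ne_one hθ h0).symm)
    · exact norm_pos_iff.2 (Complex.slitPlane_ne_zero (one_sub_sg_mem_slitPlane (norm_ee θ).le))
  linarith [two_mul_norm_one_add_ee_le θ]

theorem measurable_lam : Measurable lam := by
  have := continuous_ee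
  refine Measurable.div ?_ ?_
  · exact Continuous.measurable (by fun_prop)
  · refine Continuous.measurable ?_
    unfold rowSym axisSym
    fun_prop

theorem measurable_rowF (y : ℤ) : Measurable (rowF y) := by
  have h1 := measurable_lam
  have h2 : Measurable fun θ => slitF (ee θ) := measurable_slitF.comp continuous_ee.measurable
  have h3 : Measurable fun θ => (starRingEnd ℂ) (lam θ) :=
    Complex.continuous_conj.measurable.comp h1
  unfold rowF
  fun_prop

theorem norm_rowF (y : ℤ) (θ : ℝ) : ‖rowF y θ‖ = ‖slitF (ee θ)‖ * ‖lam θ‖ ^ y.natAbs := by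
  rw [rowF, norm_mul, norm_mul, norm_pow, norm_pow, RCLike.norm_conj, ← pow_add]
  congr 2
  omega

theorem integrable_rowF (y : ℤ) : Integrable (rowF y) period := by
  refine integrable_slitF.mono (measurable_rowF y).aestronglyMeasurable
    (Filter.Eventually.of_forall fun θ => ?_)
  rw [norm_rowF]
  exact mul_le_of_le_one_right (norm_nonneg _)
    (pow_le_one₀ (norm_nonneg _) (norm_lam_le_one θ))

theorem coef_shift (f : ℝ → ℂ) (m n : ℤ) :
    coef f (n + m) = coef (fun θ => f θ * ee θ ^ (-m)) n := by
  unfold coef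
  congr 2
  funext θ
  rw [mul_assoc, ← zpow_add₀ (ee_ne_zero θ)]
  congr 2
  ring

theorem coef_add {f g : ℝ → ℂ} (hf : Integrable f period) (hg : Integrable g period) (n : ℤ) :
    coef (fun θ => f θ + g θ) n = coef f n + coef g n := by
  unfold coef
  rw [← mul_add, ← integral_add (integrable_mul_ee_zpow hf _) (integrable_mul_ee_zpow hg _)]
  simp only [add_mul]

theorem coef_const_mul (c : ℂ) (f : ℝ → ℂ) (n : ℤ) :
    coef (fun θ => c * f θ) n = c * coef f n := by
  unfold coef
  simp only [mul_assoc, integral_const_mul]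
  ring

theorem coef_conj (f : ℝ → ℂ) (n : ℤ) :
    coef (fun θ => (starRingEnd ℂ) (f θ)) n = (starRingEnd ℂ) (coef f (-n)) := by
  unfold coef
  rw [map_mul, ← integral_conj]
  simp [conj_ee, Complex.conj_ofNat]

theorem coef_laplacian {f g k : ℝ → ℂ} (hf : Integrable f period) (hg : Integrable g period)
    (hk : Integrable k period) (x : ℤ) :
    6 * coef f x - (coef f (x + 1) + coef f (x - 1) + coef g x + coef k x + coef g (x + 1)
      + coef k (x - 1)) =
    coef (fun θ => (6 - ee θ - (ee θ)⁻¹) * f θ - (1 + (ee θ)⁻¹) * g θ - (1 + ee θ) * k θ) x := by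
  have hs := fun (m : ℤ) {u : ℝ → ℂ} (hu : Integrable u period) => integrable_mul_ee_zpow hu m
  have hsum : ∀ θ, (6 - ee θ - (ee θ)⁻¹) * f θ - (1 + (ee θ)⁻¹) * g θ - (1 + ee θ) * k θ =
      6 * f θ + (-1) * (f θ * ee θ ^ (-1 : ℤ) + f θ * ee θ ^ (-(-1) : ℤ) + g θ + k θ
        + g θ * ee θ ^ (-1 : ℤ) + k θ * ee θ ^ (-(-1) : ℤ)) := by
    intro θ
    simp only [neg_neg, zpow_one, zpow_neg]
    ring
  simp only [hsum]
  have i2 := (hs (-1) hf).fun_add (hs (-(-1)) hf)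
  have i3 := i2.fun_add hg
  have i4 := i3.fun_add hk
  have i5 := i4.fun_add (hs (-1) hg)
  have i6 := i5.fun_add (hs (-(-1)) hk)
  rw [coef_add (hf.const_mul 6) (i6.const_mul (-1)), coef_const_mul, coef_const_mul,
    coef_add i5 (hs (-(-1)) hk), coef_add i4 (hs (-1) hg), coef_add i3 hk, coef_add i2 hg,
    coef_add (hs (-1) hf) (hs (-(-1)) hf), sub_eq_add_neg x 1]
  simp only [coef_shift _ 1, coef_shift _ (-1)]
  ring

theorem rowF_relation {y : ℤ} (hy : y ≠ 0) (θ : ℝ) :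
    (6 - ee θ - (ee θ)⁻¹) * rowF y θ - (1 + (ee θ)⁻¹) * rowF (y + 1) θ
      - (1 + ee θ) * rowF (y - 1) θ = 0 := by
  rw [← rowSym_eq]
  rcases lt_or_gt_of_ne hy with h | h
  · obtain ⟨m, rfl⟩ : ∃ m : ℕ, y = -(m + 1 : ℕ) := ⟨(-y - 1).toNat, by omega⟩
    have e1 : (-((m + 1 : ℕ) : ℤ)).toNat = 0 := by omega
    have e2 : (-((m + 1 : ℕ) : ℤ) + 1).toNat = 0 := by omega
    have e3 : (-((m + 1 : ℕ) : ℤ) - 1).toNat = 0 := by omega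
    have e4 : (-(-((m + 1 : ℕ) : ℤ))).toNat = m + 1 := by omega
    have e5 : (-(-((m + 1 : ℕ) : ℤ) + 1)).toNat = m := by omega
    have e6 : (-(-((m + 1 : ℕ) : ℤ) - 1)).toNat = m + 2 := by omega
    simp only [rowF, e1, e2, e3, e4, e5, e6]
    linear_combination slitF (ee θ) * (starRingEnd ℂ) (lam θ) ^ m * conj_lam_quadratic θ
  · obtain ⟨m, rfl⟩ : ∃ m : ℕ, y = (m + 1 : ℕ) := ⟨(y - 1).toNat, by omega⟩
    have e1 : (-((m + 1 : ℕ) : ℤ)).toNat = 0 := by omega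
    have e2 : (-(((m + 1 : ℕ) : ℤ) + 1)).toNat = 0 := by omega
    have e3 : (-(((m + 1 : ℕ) : ℤ) - 1)).toNat = 0 := by omega
    have e4 : (((m + 1 : ℕ) : ℤ)).toNat = m + 1 := by omega
    have e5 : (((m + 1 : ℕ) : ℤ) + 1).toNat = m + 2 := by omega
    have e6 : (((m + 1 : ℕ) : ℤ) - 1).toNat = m := by omega
    simp only [rowF, e1, e2, e3, e4, e5, e6]
    linear_combination slitF (ee θ) * lam θ ^ m * lam_quadratic θ

theorem rowF_zero (θ : ℝ) : rowF 0 θ = slitF (ee θ) := by simp [rowF]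

theorem rowF_relation_zero (θ : ℝ) :
    (6 - ee θ - (ee θ)⁻¹) * rowF 0 θ - (1 + (ee θ)⁻¹) * rowF (0 + 1) θ
      - (1 + ee θ) * rowF (0 - 1) θ = (starRingEnd ℂ) (rootG (ee θ)) := by
  rw [← rowSym_eq, ← axisSym_mul_slitF]
  have e1 : (-1 : ℤ).toNat = 0 := rfl
  norm_num [rowF, e1]
  linear_combination slitF (ee θ) * lam_axis θ

/-- The Green's function. -/
noncomputable def green (v : ℤ × ℤ) : ℝ := (coef (rowF v.2) v.1).re

theorem coef_rowF_zero (n : ℤ) :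
    coef (rowF 0) n = if 0 ≤ n then taylorCoeff slitF n.toNat else 0 := by
  rw [← coef_slitF]
  congr 1
  funext θ
  exact rowF_zero θ

theorem green_laplacian (v : ℤ × ℤ) (hv : ¬(v.2 = 0 ∧ v.1 ≤ -1)) :
    6 * green v -
      (green (v.1 + 1, v.2) + green (v.1 - 1, v.2) + green (v.1, v.2 + 1) +
        green (v.1, v.2 - 1) + green (v.1 + 1, v.2 + 1) + green (v.1 - 1, v.2 - 1)) =
      if v = (0, 0) then 1 else 0 := by
  obtain ⟨x, y⟩ := v
  have h6 : ∀ z : ℂ, (6 * z).re = 6 * z.re := fun z => by simp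
  have h := congrArg Complex.re (coef_laplacian (integrable_rowF y) (integrable_rowF (y + 1))
    (integrable_rowF (y - 1)) x)
  simp only [Complex.sub_re, Complex.add_re, h6] at h
  simp only [green]
  rw [h]
  by_cases hy : y = 0
  · subst hy
    have hx : 0 ≤ x := by
      by_contra hx
      exact hv ⟨rfl, by change x ≤ -1; omega⟩
    simp only [rowF_relation_zero]
    rw [coef_conj, coef_rootG]
    by_cases hx0 : x = 0
    · subst hx0
      simp [taylorCoeff_zero, rootG_zero]
    · rw [if_neg (by omega), if_neg (by simp [hx0])]
      simp
  · simp only [rowF_relation hy]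
    rw [if_neg (by simp [hy])]
    simp [coef]

theorem abs_green_le (v : ℤ × ℤ) :
    |green v| ≤ (1 / (2 * Real.pi)) * ∫ θ, ‖slitF (ee θ)‖ * ‖lam θ‖ ^ v.2.natAbs ∂period := by
  refine (Complex.abs_re_le_norm _).trans ((norm_coef_le _ _).trans_eq ?_)
  simp only [norm_rowF]

theorem tendsto_integral_rowF : Filter.Tendsto (fun m : ℕ =>
    (1 / (2 * Real.pi)) * ∫ θ, ‖slitF (ee θ)‖ * ‖lam θ‖ ^ m ∂period) Filter.atTop (nhds 0) := by
  have h : Filter.Tendsto (fun m : ℕ => ∫ θ, ‖slitF (ee θ)‖ * ‖lam θ‖ ^ m ∂period)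
      Filter.atTop (nhds (∫ _, (0 : ℝ) ∂period)) := by
    have h2 : Measurable fun θ => slitF (ee θ) := measurable_slitF.comp continuous_ee.measurable
    have h1 := measurable_lam
    refine tendsto_integral_of_dominated_convergence (fun θ => ‖slitF (ee θ)‖) ?_
      integrable_slitF.norm ?_ ?_
    · intro m
      exact Measurable.aestronglyMeasurable (by fun_prop)
    · intro m
      refine Filter.Eventually.of_forall fun θ => ?_
      rw [Real.norm_of_nonneg (by positivity)]
      exact mul_le_of_le_one_right (norm_nonneg _)
        (pow_le_one₀ (norm_nonneg _) (norm_lam_le_one θ))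
    · filter_upwards [ae_period] with θ hθ
      have := (tendsto_pow_atTop_nhds_zero_of_lt_one (norm_nonneg _)
        (norm_lam_lt_one hθ.1 hθ.2)).const_mul ‖slitF (ee θ)‖
      simpa using this
  simpa using h.const_mul (1 / (2 * Real.pi))

theorem abs_green_bounded (v : ℤ × ℤ) :
    |green v| ≤ (1 / (2 * Real.pi)) * ∫ θ, ‖slitF (ee θ)‖ ∂period := by
  refine (abs_green_le v).trans ?_
  refine mul_le_mul_of_nonneg_left ?_ (by positivity)
  refine integral_mono_of_nonneg (Filter.Eventually.of_forall fun θ => by positivity)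
    integrable_slitF.norm (Filter.Eventually.of_forall fun θ => ?_)
  exact mul_le_of_le_one_right (norm_nonneg _)
    (pow_le_one₀ (norm_nonneg _) (norm_lam_le_one θ))

theorem tendsto_green : Filter.Tendsto green Filter.cofinite (nhds 0) := by
  rw [Metric.tendsto_nhds]
  intro ε hε
  obtain ⟨N, hN⟩ := Filter.eventually_atTop.1 (tendsto_integral_rowF.eventually (gt_mem_nhds hε))
  rw [Filter.eventually_cofinite]
  have hrow : ∀ y : ℤ, {x : ℤ | ¬ |green (x, y)| < ε}.Finite := by
    intro y
    have h1 : Filter.Tendsto (fun x : ℤ => green (x, y)) Filter.cofinite (nhds 0) := by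
      have := (Complex.continuous_re.tendsto 0).comp (tendsto_coef (rowF y))
      rwa [Complex.zero_re] at this
    have h2 := (Metric.tendsto_nhds.1 h1) ε hε
    rw [Filter.eventually_cofinite] at h2
    simpa using h2
  refine ((Set.finite_Icc (-(N : ℤ)) N).biUnion
    (t := fun y => (fun x : ℤ => (x, y)) '' {x : ℤ | ¬ |green (x, y)| < ε})
    (fun y _ => (hrow y).image _)).subset ?_
  rintro ⟨x, y⟩ hv
  simp only [Real.dist_0_eq_abs, Set.mem_ofPred_eq] at hv
  have hy : ¬ N ≤ y.natAbs := fun hy => hv ((abs_green_le (x, y)).trans_lt (hN _ hy))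
  refine Set.mem_biUnion (x := y) ⟨by omega, by omega⟩ ⟨x, hv, rfl⟩

theorem green_of_mem_ray (v : ℤ × ℤ) (hv : v.2 = 0 ∧ v.1 ≤ -1) : green v = 0 := by
  obtain ⟨h1, h2⟩ := hv
  rw [green, h1, coef_rowF_zero, if_neg (by omega), Complex.zero_re]

theorem isTriSlitGreen_green : IsTriSlitGreen green := by
  refine ⟨⟨_, abs_green_bounded⟩, ?_, green_of_mem_ray, tendsto_green, green_laplacian⟩
  refine nonneg_of_superharmonic tendsto_green (fun v hv => (green_of_mem_ray v hv).ge) ?_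
  intro v hv
  rw [green_laplacian v hv]
  split_ifs <;> norm_num

theorem green_axis (n : ℕ) : green (n, 0) = (taylorCoeff slitF n).re := by
  rw [green, coef_rowF_zero, if_pos (by simp), Int.toNat_natCast]

theorem hasSum_green_axis {t : ℝ} (ht0 : 0 ≤ t) (ht : t < 1) :
    HasSum (fun x : ℕ => green ((x : ℤ), 0) * t ^ x)
      (sg / Real.sqrt ((1 - t) * (1 - sg ^ 2 * t))) := by
  have h := Complex.hasSum_re (hasSum_slitF (z := (t : ℂ)) (by simpa [abs_of_nonneg ht0] using ht))
  rw [slitF, rootG_ofReal ht, ← Complex.ofReal_div, Complex.ofReal_re] at h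
  refine h.congr_fun fun n => ?_
  rw [green_axis, ← Complex.ofReal_pow, Complex.re_mul_ofReal]

end TriSlit

/-- The triangular slit-plane Green's function exists and is unique; its generating
function along the positive `x`-axis is `(2-√3)/√((1-t)(1-(7-4√3)t))`, and in
particular `h(0,0) = 2-√3` and `h(1,0) = 14-8√3`. -/
theorem triSlitGreen_existsUnique_and_gf :
    (∃! h : ℤ × ℤ → ℝ, IsTriSlitGreen h) ∧
    (∀ h : ℤ × ℤ → ℝ, IsTriSlitGreen h →
      (∀ t : ℝ, 0 ≤ t → t < 1 →
        HasSum (fun x : ℕ => h ((x : ℤ), 0) * t ^ x)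
          ((2 - Real.sqrt 3) /
            Real.sqrt ((1 - t) * (1 - (7 - 4 * Real.sqrt 3) * t)))) ∧
      h (0, 0) = 2 - Real.sqrt 3 ∧ h (1, 0) = 14 - 8 * Real.sqrt 3) := by
  refine ⟨⟨TriSlit.green, TriSlit.isTriSlitGreen_green, fun h hh =>
    TriSlit.isTriSlitGreen_unique hh TriSlit.isTriSlitGreen_green⟩, fun h hh => ?_⟩
  obtain rfl := TriSlit.isTriSlitGreen_unique hh TriSlit.isTriSlitGreen_green
  refine ⟨fun t ht0 ht => ?_, ?_, ?_⟩
  · rw [← TriSlit.sg_sq_eq]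
    exact TriSlit.hasSum_green_axis ht0 ht
  · have := TriSlit.green_axis 0
    rwa [TriSlit.taylorCoeff_zero, TriSlit.slitF_zero, Complex.ofReal_re] at this
  · have := TriSlit.green_axis 1
    rwa [TriSlit.taylorCoeff_one, TriSlit.deriv_slitF_zero, Complex.ofReal_re] at this
end

section
/- Tripod Temperley bijection: the perfect matchings of H_NE are in bijection with the spanning trees of G that have an NE-tripod at v_t to v₁, v₂, v₃; in particular, the number of perfect matchings of H_NE equals the number of such spanning trees. -/
/-- The square lattice graph on `ℤ²`: two vertices are adjacent when at Euclidean
distance `1`. -/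
def lattice : SimpleGraph (ℤ × ℤ) :=
  SimpleGraph.fromRel (fun p q => (p.1 - q.1) ^ 2 + (p.2 - q.2) ^ 2 = 1)

/-- The vertex set `{0,…,n-1}²` of the `n×n` grid graph `G`. -/
def gBox (n : ℕ) : Set (ℤ × ℤ) :=
  {p | 0 ≤ p.1 ∧ p.1 ≤ (n : ℤ) - 1 ∧ 0 ≤ p.2 ∧ p.2 ≤ (n : ℤ) - 1}

/-- The vertex set `{0,…,2n-2}²` of the `(2n-1)×(2n-1)` grid graph `H`. -/
def hBox (n : ℕ) : Set (ℤ × ℤ) :=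
  {p | 0 ≤ p.1 ∧ p.1 ≤ 2 * (n : ℤ) - 2 ∧ 0 ≤ p.2 ∧ p.2 ≤ 2 * (n : ℤ) - 2}

/-- The vertex `2v` of `H` corresponding to a vertex `v` of `G`. -/
def dbl (p : ℤ × ℤ) : ℤ × ℤ := (2 * p.1, 2 * p.2)

/-- `p` is an interior vertex of the `n×n` grid. -/
def Interior (n : ℕ) (p : ℤ × ℤ) : Prop :=
  1 ≤ p.1 ∧ p.1 ≤ (n : ℤ) - 2 ∧ 1 ≤ p.2 ∧ p.2 ≤ (n : ℤ) - 2

/-- `p` is a boundary vertex of the `n×n` grid. -/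
def Boundary (n : ℕ) (p : ℤ × ℤ) : Prop :=
  p ∈ gBox n ∧ (p.1 = 0 ∨ p.1 = (n : ℤ) - 1 ∨ p.2 = 0 ∨ p.2 = (n : ℤ) - 1)

/-- The vertex set of `H_NE`: the `(2n-1)×(2n-1)` grid with the five vertices
`2v₁, 2v₂, 2v₃, 2v_t+(1,0), 2v_t+(0,1)` deleted. -/
def HNEset (n : ℕ) (vt v1 v2 v3 : ℤ × ℤ) : Set (ℤ × ℤ) :=
  hBox n \ {dbl v1, dbl v2, dbl v3, (2 * vt.1 + 1, 2 * vt.2), (2 * vt.1, 2 * vt.2 + 1)}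

/-- A graph `T` on the `n×n` grid has an NE-tripod at `vt` to `v1, v2, v3`: it
contains three paths from `vt` to `v1`, `v2`, `v3` pairwise having only the vertex
`vt` in common, such that the edge from `vt` to its east neighbor and the edge from
`vt` to its north neighbor are each the initial edge of one of the three paths. -/
def HasNETripod (n : ℕ) (T : SimpleGraph ↥(gBox n))
    (vt v1 v2 v3 east north : ↥(gBox n)) : Prop :=
  ∃ (p₁ : T.Walk vt v1) (p₂ : T.Walk vt v2) (p₃ : T.Walk vt v3),
    p₁.IsPath ∧ p₂.IsPath ∧ p₃.IsPath ∧
    (∀ x, x ∈ p₁.support → x ∈ p₂.support → x = vt) ∧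
    (∀ x, x ∈ p₁.support → x ∈ p₃.support → x = vt) ∧
    (∀ x, x ∈ p₂.support → x ∈ p₃.support → x = vt) ∧
    (p₁.getVert 1 = east ∨ p₂.getVert 1 = east ∨ p₃.getVert 1 = east) ∧
    (p₁.getVert 1 = north ∨ p₂.getVert 1 = north ∨ p₃.getVert 1 = north)

/-- The reflection of `p` in `d`: for adjacent `p`, `d` this is the point two steps away from `p`
across `d`. -/
def across (d p : ℤ × ℤ) : ℤ × ℤ := (2 * d.1 - p.1, 2 * d.2 - p.2)

/-- Both coordinates of `p` have residue `c` modulo `2`; for `c = 0` these are the vertices of the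
doubled grid, and for `c = 1` its faces. -/
def HasParity (c : ℤ) (p : ℤ × ℤ) : Prop := p.1 % 2 = c ∧ p.2 % 2 = c

/-- The coordinates of `p` have different parities: `p` is the midpoint of an edge. -/
def IsMid (p : ℤ × ℤ) : Prop := (p.1 + p.2) % 2 = 1

lemma lattice_adj {p q : ℤ × ℤ} : lattice.Adj p q ↔
    (q.1 = p.1 + 1 ∧ q.2 = p.2) ∨ (q.1 = p.1 - 1 ∧ q.2 = p.2) ∨
    (q.1 = p.1 ∧ q.2 = p.2 + 1) ∨ (q.1 = p.1 ∧ q.2 = p.2 - 1) := by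
  obtain ⟨a, b⟩ := p
  obtain ⟨x, y⟩ := q
  simp only [lattice, SimpleGraph.fromRel_adj, ne_eq, Prod.mk.injEq]
  constructor
  · rintro ⟨-, h⟩
    have h : (x - a) ^ 2 + (y - b) ^ 2 = 1 := by rcases h with h | h <;> linarith
    have h1 : -1 ≤ x - a := by nlinarith [sq_nonneg (y - b)]
    have h2 : x - a ≤ 1 := by nlinarith [sq_nonneg (y - b)]
    have h3 : -1 ≤ y - b := by nlinarith [sq_nonneg (x - a)]
    have h4 : y - b ≤ 1 := by nlinarith [sq_nonneg (x - a)]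
    generalize hs : x - a = s at *
    generalize ht : y - b = t at *
    interval_cases s <;> interval_cases t <;> omega
  · rintro (⟨rfl, rfl⟩ | ⟨rfl, rfl⟩ | ⟨rfl, rfl⟩ | ⟨rfl, rfl⟩) <;> constructor <;>
      first | omega | (left; ring)

instance : DecidableRel lattice.Adj := fun _ _ => decidable_of_iff _ lattice_adj.symm

/-- The number, modulo `2`, of points of `D` lying strictly above `q` in the same column. -/
def colAbove (D : Finset (ℤ × ℤ)) (q : ℤ × ℤ) : ZMod 2 :=
  ∑ d ∈ D, if d.1 = q.1 ∧ q.2 < d.2 then 1 else 0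

lemma colAbove_eq_zero {D : Finset (ℤ × ℤ)} {q : ℤ × ℤ}
    (h : ∀ d ∈ D, d.1 = q.1 → d.2 ≤ q.2) : colAbove D q = 0 := by
  refine Finset.sum_eq_zero fun d hd => if_neg ?_
  rintro ⟨h1, h2⟩
  have := h d hd h1
  omega

lemma ind_eq_sum (D : Finset (ℤ × ℤ)) (r : ℤ × ℤ) :
    (if r ∈ D then (1 : ZMod 2) else 0) = ∑ d ∈ D, if d = r then 1 else 0 := by
  simp

lemma colAbove_vertical {D : Finset (ℤ × ℤ)} (hD : ∀ d ∈ D, IsMid d) {c : ℤ} {q : ℤ × ℤ}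
    (hq : HasParity c q) :
    colAbove D q = colAbove D (q.1, q.2 + 2) + if (q.1, q.2 + 1) ∈ D then 1 else 0 := by
  rw [ind_eq_sum, colAbove, colAbove, ← Finset.sum_add_distrib]
  refine Finset.sum_congr rfl fun d hd => ?_
  have h := hD d hd
  obtain ⟨x, y⟩ := d
  obtain ⟨a, b⟩ := q
  simp only [IsMid, HasParity, Prod.mk.injEq] at *
  split_ifs <;> first | omega | simp

lemma colAbove_horizontal {D : Finset (ℤ × ℤ)} (hD : ∀ d ∈ D, IsMid d) {c : ℤ}
    (heven : ∀ p, HasParity c p → Even (D.filter (fun d => lattice.Adj p d)).card)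
    {q : ℤ × ℤ} (hq : HasParity (1 - c) q) :
    colAbove D q + colAbove D (q.1 + 2, q.2) + (if (q.1 + 1, q.2) ∈ D then 1 else 0) = 0 := by
  obtain ⟨N, hN⟩ : ∃ N : ℤ, ∀ d ∈ D, d.2 ≤ N := by
    obtain ⟨N, hN⟩ := (D.image Prod.snd).bddAbove
    exact ⟨N, fun d hd => hN (by simpa using ⟨d.1, hd⟩)⟩
  obtain ⟨k, hk⟩ : ∃ k : ℕ, N + 1 ≤ q.2 + k := ⟨(N + 1 - q.2).toNat, by omega⟩
  induction k using Nat.strong_induction_on generalizing q with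
  | _ k ih =>
  by_cases hqN : N + 1 ≤ q.2
  · rw [colAbove_eq_zero, colAbove_eq_zero, if_neg]
    · simp
    · intro h; have := hN _ h; simp only at this; omega
    · intro d hd _; have := hN _ hd; simp only; omega
    · intro d hd _; have := hN _ hd; omega
  have h2 : HasParity (1 - c) (q.1, q.2 + 2) := by simp only [HasParity] at *; omega
  have h3 : HasParity (1 - c) (q.1 + 2, q.2) := by simp only [HasParity] at *; omega
  have key := ih (k - 2) (by omega) h2 (by simp only; omega)
  have hp : HasParity c (q.1 + 1, q.2 + 1) := by simp only [HasParity] at *; omega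
  have hev := heven _ hp
  rw [← ZMod.natCast_eq_zero_iff_even, Finset.card_filter, Nat.cast_sum] at hev
  have hsplit : (∑ d ∈ D, ((if lattice.Adj (q.1 + 1, q.2 + 1) d then 1 else 0 : ℕ) : ZMod 2)) =
      (if (q.1 + 2, q.2 + 1) ∈ D then 1 else 0) + (if (q.1, q.2 + 1) ∈ D then 1 else 0) +
      (if (q.1 + 1, q.2 + 2) ∈ D then 1 else 0) + (if (q.1 + 1, q.2) ∈ D then 1 else 0) := by
    simp only [ind_eq_sum, ← Finset.sum_add_distrib]
    refine Finset.sum_congr rfl fun d _ => ?_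
    obtain ⟨x, y⟩ := d
    simp only [lattice_adj, Prod.mk.injEq]
    split_ifs <;> first | omega | simp
  rw [hsplit] at hev
  rw [colAbove_vertical hD hq, colAbove_vertical hD h3]
  simp only at key ⊢
  have two : (2 : ZMod 2) = 0 := rfl
  linear_combination key + hev - (if (q.1 + 1, q.2 + 2) ∈ D then (1 : ZMod 2) else 0) * two

lemma zmod_two_add_self (x : ZMod 2) : x + x = 0 := by
  rw [← two_mul, show (2 : ZMod 2) = 0 from rfl, zero_mul]

lemma colAbove_across {D : Finset (ℤ × ℤ)} (hD : ∀ d ∈ D, IsMid d) {c : ℤ}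
    (heven : ∀ p, HasParity c p → Even (D.filter (fun d => lattice.Adj p d)).card)
    {q d : ℤ × ℤ} (hq : HasParity (1 - c) q) (hqd : lattice.Adj q d) :
    colAbove D q + colAbove D (across d q) = if d ∈ D then 1 else 0 := by
  have hq' : HasParity (1 - c) (across d q) := by
    simp only [HasParity, across] at *; omega
  obtain ⟨a, b⟩ := q
  obtain ⟨x, y⟩ := d
  simp only [lattice_adj] at hqd
  rcases hqd with ⟨rfl, rfl⟩ | ⟨h, rfl⟩ | ⟨rfl, rfl⟩ | ⟨rfl, h⟩
  · rw [show across (a + 1, y) (a, y) = (a + 2, y) by ext <;> simp only [across] <;> ring]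
    linear_combination colAbove_horizontal hD heven hq
      - zmod_two_add_self (if (a + 1, y) ∈ D then 1 else 0)
  · obtain ⟨z, rfl⟩ : ∃ z, a = z + 2 := ⟨a - 2, by ring⟩
    obtain rfl : x = z + 1 := by omega
    have hz : across (z + 1, y) (z + 2, y) = (z, y) := by
      ext <;> simp only [across] <;> ring
    rw [hz] at hq' ⊢
    linear_combination colAbove_horizontal hD heven hq'
      - zmod_two_add_self (if (z + 1, y) ∈ D then 1 else 0)
  · rw [show across (x, b + 1) (x, b) = (x, b + 2) by ext <;> simp only [across] <;> ring]
    linear_combination colAbove_vertical hD hq + zmod_two_add_self (colAbove D (x, b + 2))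
  · obtain ⟨z, rfl⟩ : ∃ z, b = z + 2 := ⟨b - 2, by ring⟩
    obtain rfl : y = z + 1 := by omega
    have hz : across (x, z + 1) (x, z + 2) = (x, z) := by
      ext <;> simp only [across] <;> ring
    rw [hz] at hq' ⊢
    linear_combination colAbove_vertical hD hq' + zmod_two_add_self (colAbove D (x, z + 2))

/-- A discrete Jordan curve lemma: a nonempty finite set `D` of midpoints having an even number of
points next to each point of parity `c` is the boundary of a nonempty set `W` of points of the
opposite parity, and `W` lies strictly inside every set containing the points of parity `c` next
to `D`. -/
lemma exists_enclosed {D : Finset (ℤ × ℤ)} (hne : D.Nonempty) (hD : ∀ d ∈ D, IsMid d) {c : ℤ}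
    (hc : c = 0 ∨ c = 1)
    (heven : ∀ p, HasParity c p → Even (D.filter (fun d => lattice.Adj p d)).card)
    {P : Set (ℤ × ℤ)} (hP : ∀ d ∈ D, ∀ p, HasParity c p → lattice.Adj p d → p ∈ P) :
    ∃ W : Set (ℤ × ℤ), W.Nonempty ∧
      (∀ q ∈ W, HasParity (1 - c) q ∧ (∃ p ∈ P, p.1 < q.1) ∧ (∃ p ∈ P, q.1 < p.1) ∧
        (∃ p ∈ P, p.2 < q.2) ∧ (∃ p ∈ P, q.2 < p.2)) ∧
      (∀ q ∈ W, ∀ d, lattice.Adj q d → d ∉ D → across d q ∈ W) := by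
  refine ⟨{q | HasParity (1 - c) q ∧ colAbove D q ≠ 0}, ?_, ?_, ?_⟩
  · obtain ⟨d, hd⟩ := hne
    have hmid := hD d hd
    obtain ⟨q, hq, hqd⟩ : ∃ q, HasParity (1 - c) q ∧ lattice.Adj q d := by
      by_cases h : d.1 % 2 = c
      · refine ⟨(d.1 + 1, d.2), ?_, ?_⟩
        · simp only [HasParity, IsMid] at *; omega
        · simp [lattice_adj]
      · refine ⟨(d.1, d.2 + 1), ?_, ?_⟩
        · simp only [HasParity, IsMid] at *; omega
        · simp [lattice_adj]
    have h := colAbove_across hD heven hq hqd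
    rw [if_pos hd] at h
    by_cases h0 : colAbove D q = 0
    · refine ⟨across d q, ?_, fun h1 => ?_⟩
      · simp only [HasParity, across] at *; omega
      · rw [h0, h1] at h; exact absurd h (by decide)
    · exact ⟨q, hq, h0⟩
  · rintro q ⟨hq, hq0⟩
    have hcol : ∃ d ∈ D, d.1 = q.1 ∧ q.2 < d.2 := by
      by_contra! h
      exact hq0 (colAbove_eq_zero h)
    have hbelow : ∃ d ∈ D, d.2 ≤ q.2 := by
      by_contra! h
      have hrow : ∀ k : ℕ, colAbove D (q.1 + 2 * k, q.2) = colAbove D q := by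
        intro k
        induction k with
        | zero => simp
        | succ k ih =>
          have h1 : HasParity (1 - c) (q.1 + 2 * k, q.2) := by
            simp only [HasParity] at *; omega
          have h2 := colAbove_horizontal hD heven h1
          rw [if_neg (fun h3 => by have := h _ h3; simp only at this; omega)] at h2
          simp only at h2
          rw [show q.1 + 2 * ((k + 1 : ℕ) : ℤ) = q.1 + 2 * k + 2 by push_cast; ring]
          linear_combination h2 - ih - zmod_two_add_self (colAbove D q)
      obtain ⟨N, hN⟩ : ∃ N : ℤ, ∀ d ∈ D, d.1 ≤ N := by
        obtain ⟨N, hN⟩ := (D.image Prod.fst).bddAbove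
        exact ⟨N, fun d hd => hN (by simpa using ⟨d.2, hd⟩)⟩
      apply hq0
      rw [← hrow (N + 1 - q.1).toNat]
      refine colAbove_eq_zero fun d hd h1 => ?_
      have := hN d hd
      simp only at h1
      omega
    refine ⟨hq, ?_⟩
    obtain ⟨d, hd, hd1, hd2⟩ := hcol
    obtain ⟨d', hd', hle⟩ := hbelow
    have hmid := hD d hd
    have hmid' := hD d' hd'
    have hl : (d.1 - 1, d.2) ∈ P := by
      refine hP d hd _ ?_ ?_
      · simp only [HasParity, IsMid] at *; omega
      · simp [lattice_adj]
    have hr : (d.1 + 1, d.2) ∈ P := by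
      refine hP d hd _ ?_ ?_
      · simp only [HasParity, IsMid] at *; omega
      · simp [lattice_adj]
    refine ⟨⟨_, hl, by simp only; omega⟩, ⟨_, hr, by simp only; omega⟩, ?_, ⟨_, hr, hd2⟩⟩
    by_cases h : d'.1 % 2 = c
    · refine ⟨(d'.1, d'.2 - 1), hP d' hd' _ ?_ ?_, ?_⟩
      · simp only [HasParity, IsMid] at *; omega
      · simp [lattice_adj]
      · simp only; omega
    · refine ⟨(d'.1 + 1, d'.2), hP d' hd' _ ?_ ?_, ?_⟩
      · simp only [HasParity, IsMid] at *; omega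
      · simp [lattice_adj]
      · simp only [HasParity, IsMid] at *; omega
  · rintro q ⟨hq, hq0⟩ d hqd hdD
    refine ⟨?_, fun h0 => hq0 ?_⟩
    · simp only [HasParity, across] at *; omega
    · have h := colAbove_across hD heven hq hqd
      rwa [if_neg hdD, h0, add_zero] at h

/-- `μ` restricts to an involution of `X` moving every point to an adjacent one, that is, it
describes a perfect matching of the subgraph of the lattice induced on `X`. -/
def IsMate (X : Set (ℤ × ℤ)) (μ : ℤ × ℤ → ℤ × ℤ) : Prop :=
  ∀ a ∈ X, μ a ∈ X ∧ lattice.Adj a (μ a) ∧ μ (μ a) = a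

lemma eq_or_eq_across {c : ℤ} {p r d : ℤ × ℤ} (hp : HasParity c p) (hr : HasParity c r)
    (hpd : lattice.Adj p d) (hrd : lattice.Adj r d) : r = p ∨ r = across d p := by
  simp only [HasParity, lattice_adj, across, Prod.ext_iff] at *
  omega

lemma HasParity.across {c : ℤ} {p : ℤ × ℤ} (hp : HasParity c p) (d : ℤ × ℤ) :
    HasParity c (across d p) := by
  simp only [HasParity, _root_.across] at *
  omega

lemma HasParity.isMid {c : ℤ} {p d : ℤ × ℤ} (hp : HasParity c p) (h : lattice.Adj p d) :
    IsMid d := by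
  simp only [HasParity, IsMid, lattice_adj] at *
  omega

lemma adj_across {p d : ℤ × ℤ} (h : lattice.Adj p d) : lattice.Adj (across d p) d := by
  simp only [across, lattice_adj] at *
  omega

lemma across_ne {p d : ℤ × ℤ} (h : lattice.Adj p d) : across d p ≠ p := by
  simp only [across, lattice_adj, ne_eq, Prod.ext_iff] at *
  omega

lemma exists_image_eq_self {α : Type*} [DecidableEq α] (s : α → α) (P : Finset α)
    (hne : P.Nonempty) (h : ∀ p ∈ P, s p ∈ P) : ∃ Q ⊆ P, Q.Nonempty ∧ Q.image s = Q := by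
  induction P using Finset.strongInduction with
  | H P ih =>
  by_cases hP : P.image s = P
  · exact ⟨P, subset_rfl, hne, hP⟩
  · have hsub : P.image s ⊆ P := by
      intro x hx
      obtain ⟨p, hp, rfl⟩ := Finset.mem_image.1 hx
      exact h p hp
    obtain ⟨Q, hQ, h1⟩ := ih _ (Finset.ssubset_iff_subset_ne.2 ⟨hsub, hP⟩) (hne.image s)
      (fun p hp => Finset.mem_image_of_mem s (hsub hp))
    exact ⟨Q, hQ.trans hsub, h1⟩

lemma finite_hBox (n : ℕ) : (hBox n).Finite := by
  refine (Set.finite_Icc ((0 : ℤ), (0 : ℤ)) (2 * (n : ℤ) - 2, 2 * (n : ℤ) - 2)).subset ?_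
  rintro ⟨x, y⟩ ⟨h1, h2, h3, h4⟩
  exact ⟨⟨h1, h3⟩, ⟨h2, h4⟩⟩

lemma mem_HNEset_of_inner {n : ℕ} {vt v1 v2 v3 : ℤ × ℤ} (hb1 : Boundary n v1)
    (hb2 : Boundary n v2) (hb3 : Boundary n v3) {c : ℤ} {q : ℤ × ℤ}
    (hq : HasParity c q) (h1 : 0 < q.1) (h2 : q.1 < 2 * n - 2) (h3 : 0 < q.2)
    (h4 : q.2 < 2 * n - 2) : q ∈ HNEset n vt v1 v2 v3 := by
  refine ⟨⟨h1.le, h2.le, h3.le, h4.le⟩, ?_⟩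
  obtain ⟨-, hb1⟩ := hb1
  obtain ⟨-, hb2⟩ := hb2
  obtain ⟨-, hb3⟩ := hb3
  simp only [HasParity, Set.mem_insert_iff, Set.mem_singleton_iff, dbl, Prod.ext_iff] at *
  omega

lemma exists_enclosed_closed {n : ℕ} {vt v1 v2 v3 : ℤ × ℤ} (hb1 : Boundary n v1)
    (hb2 : Boundary n v2) (hb3 : Boundary n v3) {μ : ℤ × ℤ → ℤ × ℤ}
    (hμ : IsMate (HNEset n vt v1 v2 v3) μ)
    {D : Finset (ℤ × ℤ)} (hne : D.Nonempty) (hD : ∀ d ∈ D, IsMid d) {c : ℤ}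
    (hc : c = 0 ∨ c = 1)
    (heven : ∀ p, HasParity c p → Even (D.filter (fun d => lattice.Adj p d)).card)
    {P : Set (ℤ × ℤ)} (hP : ∀ d ∈ D, ∀ p, HasParity c p → lattice.Adj p d → p ∈ P)
    (hbox : P ⊆ hBox n)
    (hμD : ∀ q ∈ HNEset n vt v1 v2 v3, HasParity (1 - c) q → μ q ∉ D) :
    ∃ W : Set (ℤ × ℤ), W.Nonempty ∧ W ⊆ HNEset n vt v1 v2 v3 ∧
      (∀ q ∈ W, HasParity (1 - c) q) ∧ (∀ q ∈ W, across (μ q) q ∈ W) ∧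
      (∀ q ∈ W, ∃ p ∈ P, q.2 < p.2) := by
  obtain ⟨W, hW, h1, h2⟩ := exists_enclosed hne hD hc heven hP
  have hsub : W ⊆ HNEset n vt v1 v2 v3 := by
    intro q hq
    obtain ⟨h0, ⟨a, ha, ha'⟩, ⟨b, hb, hb'⟩, ⟨s, hs, hs'⟩, ⟨t, ht, ht'⟩⟩ := h1 q hq
    have ha := hbox ha
    have hb := hbox hb
    have hs := hbox hs
    have ht := hbox ht
    simp only [hBox, Set.mem_ofPred_eq] at ha hb hs ht
    exact mem_HNEset_of_inner hb1 hb2 hb3 h0 (by omega) (by omega) (by omega) (by omega)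
  exact ⟨W, hW, hsub, fun q hq => (h1 q hq).1,
    fun q hq => h2 q hq _ (hμ q (hsub hq)).2.1 (hμD q (hsub hq) (h1 q hq).1),
    fun q hq => (h1 q hq).2.2.2.2⟩

/-- Following a perfect matching of `H_NE` across midpoints never stays forever inside `H_NE`. -/
lemma not_closed {n : ℕ} {vt v1 v2 v3 : ℤ × ℤ} (hb1 : Boundary n v1)
    (hb2 : Boundary n v2) (hb3 : Boundary n v3) {μ : ℤ × ℤ → ℤ × ℤ}
    (hμ : IsMate (HNEset n vt v1 v2 v3) μ) {c : ℤ} (hc : c = 0 ∨ c = 1) {P : Set (ℤ × ℤ)}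
    (hne : P.Nonempty) (hsub : P ⊆ HNEset n vt v1 v2 v3) (hpar : ∀ p ∈ P, HasParity c p)
    (hcl : ∀ p ∈ P, across (μ p) p ∈ P) : False := by
  obtain ⟨N, hN⟩ : ∃ N : ℕ, ∀ p ∈ P, p.2 ≤ N :=
    ⟨2 * n, fun p hp => by have := (hsub hp).1.2.2.2; push_cast; omega⟩
  induction N using Nat.strong_induction_on generalizing c P with
  | _ N ih =>
  have hfin : P.Finite := (finite_hBox n).subset (hsub.trans Set.sdiff_subset)
  obtain ⟨Q, hQP, hQne, hQ⟩ := exists_image_eq_self (fun p => across (μ p) p) hfin.toFinset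
    (by simpa using hne) (by simpa using hcl)
  have hQP : ∀ p ∈ Q, p ∈ P := fun p hp => by simpa using hQP hp
  have hmate : ∀ p ∈ Q, lattice.Adj p (μ p) ∧ μ (μ p) = p :=
    fun p hp => (hμ p (hsub (hQP p hp))).2
  have hinj : Set.InjOn (fun p => across (μ p) p) Q :=
    Finset.card_image_iff.1 (by rw [hQ])
  have hmem : ∀ p ∈ Q, across (μ p) p ∈ Q := fun p hp => by
    rw [← hQ]; exact Finset.mem_image_of_mem _ hp
  obtain ⟨W, hW, hWsub, hWpar, hWcl, hWlt⟩ :=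
    exists_enclosed_closed hb1 hb2 hb3 hμ (D := Q.image μ) (hQne.image μ) (c := c) (P := P)
    (by
      intro d hd
      obtain ⟨p, hp, rfl⟩ := Finset.mem_image.1 hd
      exact (hpar p (hQP p hp)).isMid (hmate p hp).1) hc
    (by
      intro p hp
      by_cases hpQ : p ∈ Q
      · obtain ⟨q, hq, hqp⟩ := Finset.mem_image.1 (hQ.symm ▸ hpQ : p ∈ Q.image _)
        have hne' : μ p ≠ μ q := by
          intro h
          have hpq : p = q := by rw [← (hmate p hpQ).2, ← (hmate q hq).2, h]
          subst hpq
          exact across_ne (hmate p hpQ).1 hqp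
        have : (Q.image μ).filter (fun d => lattice.Adj p d) = {μ p, μ q} := by
          ext d
          simp only [Finset.mem_filter, Finset.mem_image, Finset.mem_insert, Finset.mem_singleton]
          constructor
          · rintro ⟨⟨r, hr, rfl⟩, had⟩
            rcases eq_or_eq_across (hpar r (hQP r hr)) hp (hmate r hr).1 had with h | h
            · exact Or.inl (by rw [h])
            · exact Or.inr (by rw [hinj hr hq (h.symm.trans hqp.symm)])
          · rintro (rfl | rfl)
            · exact ⟨⟨p, hpQ, rfl⟩, (hmate p hpQ).1⟩
            · exact ⟨⟨q, hq, rfl⟩, hqp ▸ adj_across (hmate q hq).1⟩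
        rw [this, Finset.card_pair hne']
        exact even_two
      · rw [Finset.filter_eq_empty_iff.2, Finset.card_empty]
        · exact Even.zero
        · intro d hd had
          obtain ⟨r, hr, rfl⟩ := Finset.mem_image.1 hd
          rcases eq_or_eq_across (hpar r (hQP r hr)) hp (hmate r hr).1 had with h | h
          · exact hpQ (h ▸ hr)
          · exact hpQ (h ▸ hmem r hr))
    (by
      intro d hd p hp had
      obtain ⟨r, hr, rfl⟩ := Finset.mem_image.1 hd
      rcases eq_or_eq_across (hpar r (hQP r hr)) hp (hmate r hr).1 had with h | h
      · exact h ▸ hQP r hr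
      · exact h ▸ hQP _ (hmem r hr))
    (hsub.trans Set.sdiff_subset)
    (by
      intro q hq hqpar hqD
      obtain ⟨r, hr, h⟩ := Finset.mem_image.1 hqD
      have : r = q := by rw [← (hmate r hr).2, h, (hμ q hq).2.2]
      have h1 := hpar r (hQP r hr)
      rw [this] at h1
      simp only [HasParity] at *
      omega)
  obtain ⟨q, hq⟩ := hW
  obtain ⟨p, hp, hlt⟩ := hWlt q hq
  have h0 := hN p hp
  have h1 : 0 ≤ q.2 := (hWsub hq).1.2.2.1
  refine ih (N - 1) (by omega) (by omega) ⟨q, hq⟩ hWsub hWpar hWcl fun q hq => ?_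
  obtain ⟨p, hp, hlt⟩ := hWlt q hq
  have := hN p hp
  omega

/-- The midpoint of the edge `{u, v}` of the grid, as a point of the doubled grid. -/
def mid (u v : ℤ × ℤ) : ℤ × ℤ := (u.1 + v.1, u.2 + v.2)

lemma mid_comm (u v : ℤ × ℤ) : mid u v = mid v u := by
  simp only [mid, add_comm]

lemma hasParity_dbl (u : ℤ × ℤ) : HasParity 0 (dbl u) := by
  simp only [HasParity, dbl]
  omega

lemma dbl_mem_hBox {n : ℕ} {u : ℤ × ℤ} : dbl u ∈ hBox n ↔ u ∈ gBox n := by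
  simp only [hBox, gBox, dbl, Set.mem_ofPred_eq]
  omega

lemma dbl_injective : Function.Injective dbl := by
  intro u v h
  simp only [dbl, Prod.ext_iff] at *
  omega

lemma exists_eq_dbl {p : ℤ × ℤ} (hp : HasParity 0 p) : ∃ u, p = dbl u := by
  refine ⟨(p.1 / 2, p.2 / 2), ?_⟩
  simp only [HasParity, dbl, Prod.ext_iff] at *
  omega

lemma adj_dbl_mid_iff {x u v : ℤ × ℤ} (h : lattice.Adj u v) :
    lattice.Adj (dbl x) (mid u v) ↔ x = u ∨ x = v := by
  simp only [lattice_adj, dbl, mid, Prod.ext_iff] at *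
  omega

lemma adj_dbl_mid {u v : ℤ × ℤ} (h : lattice.Adj u v) : lattice.Adj (dbl u) (mid u v) :=
  (adj_dbl_mid_iff h).2 (Or.inl rfl)

lemma isMid_mid {u v : ℤ × ℤ} (h : lattice.Adj u v) : IsMid (mid u v) :=
  (hasParity_dbl u).isMid (adj_dbl_mid h)

lemma mid_eq_mid {u v u' v' : ℤ × ℤ} (h : lattice.Adj u v) (h' : lattice.Adj u' v')
    (he : mid u v = mid u' v') : (u = u' ∧ v = v') ∨ (u = v' ∧ v = u') := by
  simp only [lattice_adj, mid, Prod.ext_iff] at *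
  omega

lemma mid_mem_hBox {n : ℕ} {u v : ℤ × ℤ} (hu : u ∈ gBox n) (hv : v ∈ gBox n) :
    mid u v ∈ hBox n := by
  simp only [hBox, gBox, mid, Set.mem_ofPred_eq] at *
  omega

lemma exists_eq_mid {n : ℕ} {d : ℤ × ℤ} (hd : IsMid d) (hbox : d ∈ hBox n) :
    ∃ u ∈ gBox n, ∃ v ∈ gBox n, lattice.Adj u v ∧ d = mid u v := by
  refine ⟨(d.1 / 2, d.2 / 2), ?_, ((d.1 + 1) / 2, (d.2 + 1) / 2), ?_, ?_, ?_⟩ <;>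
  · simp only [IsMid, hBox, gBox, mid, lattice_adj, Set.mem_ofPred_eq, Prod.ext_iff] at *
    omega

/-- The set of midpoints of the edges of `T`. -/
def edgeMids {n : ℕ} (T : SimpleGraph ↥(gBox n)) : Set (ℤ × ℤ) :=
  {d | ∃ u v : ↥(gBox n), T.Adj u v ∧ d = mid u v}

lemma mid_mem_edgeMids {n : ℕ} {T : SimpleGraph ↥(gBox n)} (hT : T ≤ lattice.induce (gBox n))
    {u v : ↥(gBox n)} (h : lattice.Adj (u : ℤ × ℤ) v) :
    mid u v ∈ edgeMids T ↔ T.Adj u v := by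
  constructor
  · rintro ⟨a, b, hab, he⟩
    rcases mid_eq_mid h (hT hab) he with ⟨h1, h2⟩ | ⟨h1, h2⟩
    · rwa [Subtype.ext h1, Subtype.ext h2]
    · rw [Subtype.ext h1, Subtype.ext h2]
      exact hab.symm
  · exact fun h => ⟨u, v, h, rfl⟩

/-- The midpoint of an unordered pair of grid points. -/
def symMid {n : ℕ} : Sym2 ↥(gBox n) → ℤ × ℤ :=
  Sym2.lift ⟨fun u v => mid u v, fun u v => mid_comm u v⟩

lemma symMid_mk {n : ℕ} (u v : ↥(gBox n)) : symMid s(u, v) = mid u v := rfl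

lemma symMid_injOn {n : ℕ} {T : SimpleGraph ↥(gBox n)} (hT : T ≤ lattice.induce (gBox n)) :
    Set.InjOn symMid T.edgeSet := by
  intro e he f hf h
  induction e with | _ a b =>
  induction f with | _ x y =>
  rw [symMid_mk, symMid_mk] at h
  have he : lattice.Adj (a : ℤ × ℤ) b := hT he
  have hf : lattice.Adj (x : ℤ × ℤ) y := hT hf
  rcases mid_eq_mid he hf h with ⟨h1, h2⟩ | ⟨h1, h2⟩
  · rw [Subtype.ext h1, Subtype.ext h2]
  · rw [Subtype.ext h1, Subtype.ext h2, Sym2.eq_swap]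

lemma image_symMid_edgeSet {n : ℕ} (T : SimpleGraph ↥(gBox n)) :
    symMid '' T.edgeSet = edgeMids T := by
  ext d
  constructor
  · rintro ⟨e, he, rfl⟩
    induction e with | _ a b => exact ⟨a, b, he, rfl⟩
  · rintro ⟨a, b, hab, rfl⟩
    exact ⟨s(a, b), hab, rfl⟩

lemma finite_gBox (n : ℕ) : (gBox n).Finite :=
  ((finite_hBox n).preimage dbl_injective.injOn).subset fun _ hu => dbl_mem_hBox.2 hu

instance (n : ℕ) : Finite ↥(gBox n) := (finite_gBox n).to_subtype

lemma exists_leaf {V : Type*} [Finite V] {G : SimpleGraph V} (hG : G.IsAcyclic) {a b : V}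
    (hab : G.Adj a b) : ∃ u w, G.Adj u w ∧ ∀ x, G.Adj u x → x = w := by
  have : Nonempty V := ⟨a⟩
  obtain ⟨u, v, p, hp, hmax⟩ :=
    SimpleGraph.Walk.exists_isPath_forall_isPath_length_le_length G
  have hnil : ¬ p.Nil := by
    intro h
    have h1 := hmax a b hab.toWalk (by simp [hab.ne])
    rw [← SimpleGraph.Walk.length_eq_zero_iff] at h
    simp [h] at h1
  refine ⟨u, _, p.adj_snd hnil, fun w hadj => hG.eq_snd_of_adj_start hp hadj ?_⟩
  by_contra hw
  have := hmax _ _ _ (hp.cons (h := hadj.symm) hw)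
  simp at this

lemma not_isAcyclic_of_even {n : ℕ} {T : SimpleGraph ↥(gBox n)}
    (hT : T ≤ lattice.induce (gBox n)) {D : Finset (ℤ × ℤ)} (hne : D.Nonempty)
    (hD : ∀ d ∈ D, d ∈ edgeMids T)
    (heven : ∀ p, HasParity 0 p → Even (D.filter (fun d => lattice.Adj p d)).card) :
    ¬ T.IsAcyclic := by
  intro hac
  let T' : SimpleGraph ↥(gBox n) :=
    { Adj := fun u v => T.Adj u v ∧ mid u v ∈ D
      symm := ⟨fun u v h => ⟨h.1.symm, mid_comm u v ▸ h.2⟩⟩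
      loopless := ⟨fun u h => h.1.ne rfl⟩ }
  have hac' : T'.IsAcyclic := hac.anti (fun _ _ h => h.1)
  obtain ⟨d, hd⟩ := hne
  obtain ⟨a, b, hab, rfl⟩ := hD d hd
  obtain ⟨u, w, huw, hu⟩ := exists_leaf hac' (show T'.Adj a b from ⟨hab, hd⟩)
  have h := heven _ (hasParity_dbl u)
  have : D.filter (fun d => lattice.Adj (dbl u) d) = {mid u w} := by
    ext d
    simp only [Finset.mem_filter, Finset.mem_singleton]
    constructor
    · rintro ⟨hd, had⟩
      obtain ⟨x, y, hxy, rfl⟩ := hD d hd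
      rcases (adj_dbl_mid_iff (hT hxy)).1 had with h1 | h1
      · obtain rfl := Subtype.ext h1
        rw [hu y ⟨hxy, hd⟩]
      · obtain rfl := Subtype.ext h1
        rw [hu x ⟨hxy.symm, mid_comm x u ▸ hd⟩, mid_comm]
    · rintro rfl
      exact ⟨huw.2, adj_dbl_mid (hT huw.1)⟩
  rw [this, Finset.card_singleton] at h
  exact absurd h (by decide)

lemma exists_even_of_not_isAcyclic {n : ℕ} {T : SimpleGraph ↥(gBox n)}
    (hT : T ≤ lattice.induce (gBox n)) (hac : ¬ T.IsAcyclic) :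
    ∃ D : Finset (ℤ × ℤ), D.Nonempty ∧ (∀ d ∈ D, d ∈ edgeMids T) ∧
      ∀ p, HasParity 0 p → Even (D.filter (fun d => lattice.Adj p d)).card := by
  classical
  simp only [SimpleGraph.IsAcyclic, not_forall, not_not] at hac
  obtain ⟨v, w, hw⟩ := hac
  have hsub : ∀ e ∈ w.edges, e ∈ T.edgeSet := fun e he => w.edges_subset_edgeSet he
  refine ⟨w.edges.toFinset.image symMid, ?_, ?_, ?_⟩
  · rw [Finset.image_nonempty, List.toFinset_nonempty_iff]
    simp [hw.not_nil]
  · intro d hd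
    obtain ⟨e, he, rfl⟩ := Finset.mem_image.1 hd
    rw [← image_symMid_edgeSet]
    exact ⟨e, hsub e (by simpa using he), rfl⟩
  · intro p hp
    rw [Finset.filter_image, Finset.card_image_of_injOn
      ((symMid_injOn hT).mono (fun e he => hsub e (by simpa using (Finset.mem_filter.1 he).1)))]
    by_cases hex : ∃ e ∈ w.edges, lattice.Adj p (symMid e)
    · obtain ⟨x, rfl⟩ : ∃ x : ↥(gBox n), p = dbl x := by
        obtain ⟨e, he, had⟩ := hex
        obtain ⟨y, rfl⟩ := exists_eq_dbl hp
        have he := hsub e he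
        induction e with | _ a b =>
        rcases (adj_dbl_mid_iff (hT he)).1 had with rfl | rfl
        exacts [⟨a, rfl⟩, ⟨b, rfl⟩]
      have hcount := hw.isTrail.even_countP_edges_iff x
      have : w.edges.toFinset.filter (fun e => lattice.Adj (dbl x) (symMid e)) =
          (w.edges.filter (fun e => x ∈ e)).toFinset := by
        ext e
        simp only [Finset.mem_filter, List.mem_toFinset, List.mem_filter, decide_eq_true_eq]
        refine and_congr_right fun he => ?_
        have he := hsub e he
        induction e with | _ a b =>
        have he : lattice.Adj (a : ℤ × ℤ) b := hT he
        rw [symMid_mk, adj_dbl_mid_iff he, Sym2.mem_iff, Subtype.ext_iff, Subtype.ext_iff]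
      rw [this, List.toFinset_card_of_nodup (hw.isTrail.edges_nodup.filter _),
        ← List.countP_eq_length_filter, hcount]
      exact fun h => absurd rfl h
    · rw [Finset.filter_eq_empty_iff.2, Finset.card_empty]
      · exact Even.zero
      · exact fun e he had => hex ⟨e, by simpa using he, had⟩

lemma exists_rank {α : Type*} (r : α → α → Prop) (R : Set α) :
    ∃ (d : α → ℕ) (ν : α → α), ∀ a, (∃ b ∈ R, Relation.ReflTransGen r a b) → a ∉ R →
      r a (ν a) ∧ d (ν a) < d a := by
  classical
  let S : ℕ → α → Prop := fun k => Nat.rec (fun a => a ∈ R) (fun _ P a => ∃ b, r a b ∧ P b) k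
  have hS : ∀ a, (∃ b ∈ R, Relation.ReflTransGen r a b) → ∃ k, S k a := by
    rintro a ⟨b, hb, hab⟩
    induction hab using Relation.ReflTransGen.head_induction_on with
    | refl => exact ⟨0, hb⟩
    | head h _ ih =>
      obtain ⟨k, hk⟩ := ih
      exact ⟨k + 1, _, h, hk⟩
  let d : α → ℕ := fun a => sInf {k | S k a}
  have key : ∀ a, ∃ b, (∃ b ∈ R, Relation.ReflTransGen r a b) → a ∉ R → r a b ∧ d b < d a := by
    intro a
    by_cases h : ∃ b ∈ R, Relation.ReflTransGen r a b
    · by_cases haR : a ∈ R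
      · exact ⟨a, fun _ h => absurd haR h⟩
      · have hd : S (d a) a := Nat.sInf_mem (hS a h)
        rcases hk : d a with _ | k
        · rw [hk] at hd
          exact absurd hd haR
        · rw [hk] at hd
          obtain ⟨b, hab, hb⟩ := hd
          exact ⟨b, fun _ _ => ⟨hab, Nat.lt_succ_of_le (Nat.sInf_le hb)⟩⟩
    · exact ⟨a, fun h' => absurd h' h⟩
  choose ν hν using key
  exact ⟨d, ν, hν⟩

lemma reachable_of_getVert_one {V : Type*} {T : SimpleGraph V} {t r x : V} (p : T.Walk t r)
    (hp : p.IsPath) (htr : t ≠ r) (hx : p.getVert 1 = x) {S : Set (Sym2 V)}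
    (hS : ∀ e ∈ S, t ∈ e) : T.Adj t x ∧ (T.deleteEdges S).Reachable x r := by
  cases p with
  | nil => exact absurd rfl htr
  | cons h q =>
    rw [SimpleGraph.Walk.cons_isPath_iff] at hp
    simp only [SimpleGraph.Walk.getVert_cons_succ, SimpleGraph.Walk.getVert_zero] at hx
    subst hx
    refine ⟨h, ⟨q.toDeleteEdges S fun e he heS => hp.2 ?_⟩⟩
    exact q.mem_support_of_mem_edges he (hS e heS)

lemma hasNETripod_of_reachable {n : ℕ} {T : SimpleGraph ↥(gBox n)} (hac : T.IsAcyclic)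
    {t v1 v2 v3 e m : ↥(gBox n)} (hte : T.Adj t e) (htm : T.Adj t m) (hem : e ≠ m)
    (h1 : t ≠ v1) (h2 : t ≠ v2) (h3 : t ≠ v3)
    (hreach : ∀ x, x = t ∨ x = e ∨ x = m → ∃ r, (r = v1 ∨ r = v2 ∨ r = v3) ∧
      (T.deleteEdges {s(t, e), s(t, m)}).Reachable x r) :
    HasNETripod n T t v1 v2 v3 e m := by
  set F := T.deleteEdges {s(t, e), s(t, m)}
  have hFT : F ≤ T := T.deleteEdges_le _
  rw [SimpleGraph.isAcyclic_iff_forall_adj_isBridge] at hac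
  have hFe : F ≤ T.deleteEdges {s(t, e)} :=
    SimpleGraph.deleteEdges_anti (by simp)
  have hFm : F ≤ T.deleteEdges {s(t, m)} :=
    SimpleGraph.deleteEdges_anti (by simp)
  have nte : ¬ F.Reachable t e := fun h => hac hte (h.mono hFe)
  have ntm : ¬ F.Reachable t m := fun h => hac htm (h.mono hFm)
  have nem : ¬ F.Reachable e m := by
    intro h
    refine hac hte ?_
    have hadj : (T.deleteEdges {s(t, e)}).Adj t m := by
      rw [SimpleGraph.deleteEdges_adj]
      refine ⟨htm, ?_⟩
      simp only [Set.mem_singleton_iff, Sym2.eq_iff]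
      rintro (⟨-, h⟩ | ⟨h, -⟩)
      · exact hem h.symm
      · exact hte.ne h
    exact hadj.reachable.trans (h.mono hFe).symm
  obtain ⟨r0, hr0, w0⟩ := hreach t (by simp)
  obtain ⟨re, hre, we⟩ := hreach e (by simp)
  obtain ⟨rm, hrm, wm⟩ := hreach m (by simp)
  obtain ⟨q0, hq0⟩ := w0.exists_isPath
  obtain ⟨qe, hqe⟩ := we.exists_isPath
  obtain ⟨qm, hqm⟩ := wm.exists_isPath
  have s0 : ∀ x ∈ q0.support, F.Reachable t x := fun x hx => by
    classical exact ⟨q0.takeUntil x hx⟩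
  have se : ∀ x ∈ qe.support, F.Reachable e x := fun x hx => by
    classical exact ⟨qe.takeUntil x hx⟩
  have sm : ∀ x ∈ qm.support, F.Reachable m x := fun x hx => by
    classical exact ⟨qm.takeUntil x hx⟩
  obtain ⟨P0, hP0, hPs0⟩ : ∃ P : T.Walk t r0, P.IsPath ∧ P.support = q0.support :=
    ⟨q0.mapLe hFT, hq0.mapLe hFT, by simp⟩
  obtain ⟨Pe, hPe, hPes, hPe1⟩ : ∃ P : T.Walk t re, P.IsPath ∧ P.support = t :: qe.support ∧
      P.getVert 1 = e := by
    refine ⟨.cons hte (qe.mapLe hFT), (hqe.mapLe hFT).cons ?_, by simp, by simp⟩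
    simpa using fun h => nte (se t h).symm
  obtain ⟨Pm, hPm, hPms, hPm1⟩ : ∃ P : T.Walk t rm, P.IsPath ∧ P.support = t :: qm.support ∧
      P.getVert 1 = m := by
    refine ⟨.cons htm (qm.mapLe hFT), (hqm.mapLe hFT).cons ?_, by simp, by simp⟩
    simpa using fun h => ntm (sm t h).symm
  have de0 : ∀ x, x ∈ P0.support → x ∈ Pe.support → x = t := by
    intro x hx hx'
    rw [hPes, List.mem_cons] at hx'
    exact hx'.resolve_right fun h => nte ((s0 x (hPs0 ▸ hx)).trans (se x h).symm)
  have dm0 : ∀ x, x ∈ P0.support → x ∈ Pm.support → x = t := by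
    intro x hx hx'
    rw [hPms, List.mem_cons] at hx'
    exact hx'.resolve_right fun h => ntm ((s0 x (hPs0 ▸ hx)).trans (sm x h).symm)
  have dem : ∀ x, x ∈ Pe.support → x ∈ Pm.support → x = t := by
    intro x hx hx'
    rw [hPes, List.mem_cons] at hx
    rw [hPms, List.mem_cons] at hx'
    rcases hx with hx | hx
    · exact hx
    · exact hx'.resolve_right fun h => nem ((se x hx).trans (sm x h).symm)
  have ne0 : r0 ≠ re := by
    intro h
    have := de0 r0 P0.end_mem_support (h ▸ Pe.end_mem_support)
    grind
  have nm0 : r0 ≠ rm := by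
    intro h
    have := dm0 r0 P0.end_mem_support (h ▸ Pm.end_mem_support)
    grind
  have nem' : re ≠ rm := by
    intro h
    have := dem re Pe.end_mem_support (h ▸ Pm.end_mem_support)
    grind
  have de0' := fun x a b => de0 x b a
  have dm0' := fun x a b => dm0 x b a
  have dem' := fun x a b => dem x b a
  clear hreach w0 we wm s0 se sm
  rcases hr0 with rfl | rfl | rfl <;> rcases hre with rfl | rfl | rfl <;>
    rcases hrm with rfl | rfl | rfl <;> first
    | exact absurd rfl ne0
    | exact absurd rfl nm0
    | exact absurd rfl nem'
    | exact ⟨P0, Pe, Pm, hP0, hPe, hPm, de0, dm0, dem, by simp [hPe1], by simp [hPm1]⟩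
    | exact ⟨P0, Pm, Pe, hP0, hPm, hPe, dm0, de0, dem', by simp [hPe1], by simp [hPm1]⟩
    | exact ⟨Pe, P0, Pm, hPe, hP0, hPm, de0', dem, dm0, by simp [hPe1], by simp [hPm1]⟩
    | exact ⟨Pm, P0, Pe, hPm, hP0, hPe, dm0', dem', de0, by simp [hPe1], by simp [hPm1]⟩
    | exact ⟨Pe, Pm, P0, hPe, hPm, hP0, dem, de0', dm0', by simp [hPe1], by simp [hPm1]⟩
    | exact ⟨Pm, Pe, P0, hPm, hPe, hP0, dem', dm0', de0', by simp [hPe1], by simp [hPm1]⟩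

lemma reachable_of_hasNETripod {n : ℕ} {T : SimpleGraph ↥(gBox n)}
    {t v1 v2 v3 e m : ↥(gBox n)} (hem : e ≠ m)
    (h1 : t ≠ v1) (h2 : t ≠ v2) (h3 : t ≠ v3) (h : HasNETripod n T t v1 v2 v3 e m) :
    T.Adj t e ∧ T.Adj t m ∧
    ∀ x, x = t ∨ x = e ∨ x = m → ∃ r, (r = v1 ∨ r = v2 ∨ r = v3) ∧
      (T.deleteEdges {s(t, e), s(t, m)}).Reachable x r := by
  obtain ⟨p1, p2, p3, hp1, hp2, hp3, d12, d13, d23, he, hm⟩ := h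
  have hS : ∀ f ∈ ({s(t, e), s(t, m)} : Set (Sym2 ↥(gBox n))), t ∈ f := by
    rintro f (rfl | rfl) <;> simp
  have leg : ∀ r, t ≠ r → ∀ p : T.Walk t r, p.IsPath → ∀ x, p.getVert 1 = x →
      T.Adj t x ∧ (T.deleteEdges {s(t, e), s(t, m)}).Reachable x r ∧ x ∈ p.support := by
    intro r hr p hp x hx
    obtain ⟨a, b⟩ := reachable_of_getVert_one p hp hr hx hS
    exact ⟨a, b, hx ▸ p.getVert_mem_support 1⟩
  have free : ∀ r, ∀ p : T.Walk t r, e ∉ p.support → m ∉ p.support →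
      (T.deleteEdges {s(t, e), s(t, m)}).Reachable t r := by
    intro r p h1 h2
    refine ⟨p.toDeleteEdges _ ?_⟩
    rintro f hf (rfl | rfl)
    · exact h1 (p.mem_support_of_mem_edges hf (by simp))
    · exact h2 (p.mem_support_of_mem_edges hf (by simp))
  have l1 := leg v1 h1 p1 hp1
  have l2 := leg v2 h2 p2 hp2
  have l3 := leg v3 h3 p3 hp3
  have f1 := free v1 p1
  have f2 := free v2 p2
  have f3 := free v3 p3
  clear leg free hS
  have key : T.Adj t e ∧ T.Adj t m ∧
      (∃ r, (r = v1 ∨ r = v2 ∨ r = v3) ∧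
        (T.deleteEdges {s(t, e), s(t, m)}).Reachable t r) ∧
      (∃ r, (r = v1 ∨ r = v2 ∨ r = v3) ∧
        (T.deleteEdges {s(t, e), s(t, m)}).Reachable e r) ∧
      (∃ r, (r = v1 ∨ r = v2 ∨ r = v3) ∧
        (T.deleteEdges {s(t, e), s(t, m)}).Reachable m r) := by
    generalize T.deleteEdges {s(t, e), s(t, m)} = F at *
    have ne : ∀ x, T.Adj t x → x ≠ t := fun x h => h.ne'
    rcases he with he | he | he <;> rcases hm with hm | hm | hm <;>
      first
      | exact absurd (he.symm.trans hm) hem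
      | (simp only [he, hm, forall_eq'] at l1 l2 l3; grind)
  refine ⟨key.1, key.2.1, ?_⟩
  rintro x (rfl | rfl | rfl)
  exacts [key.2.2.1, key.2.2.2.1, key.2.2.2.2]

lemma ncard_parity (n : ℕ) {a b : ℤ} (ha : a = 0 ∨ a = 1) (hb : b = 0 ∨ b = 1) (hn : 1 ≤ n) :
    (({p ∈ hBox n | p.1 % 2 = a ∧ p.2 % 2 = b} : Set (ℤ × ℤ)).ncard : ℤ) = (n - a) * (n - b) := by
  have him : ({p ∈ hBox n | p.1 % 2 = a ∧ p.2 % 2 = b} : Set (ℤ × ℤ)) =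
      (fun q : ℤ × ℤ => (2 * q.1 + a, 2 * q.2 + b)) ''
        (Finset.Icc (0 : ℤ) (n - 1 - a) ×ˢ Finset.Icc (0 : ℤ) (n - 1 - b) : Finset (ℤ × ℤ)) := by
    ext ⟨x, y⟩
    simp only [hBox, Set.mem_ofPred_eq, Set.mem_image, Finset.coe_product, Finset.coe_Icc,
      Set.mem_prod, Set.mem_Icc, Prod.exists, Prod.mk.injEq]
    constructor
    · intro h
      exact ⟨x / 2, y / 2, by omega, by omega, by omega⟩
    · rintro ⟨u, v, h, rfl, rfl⟩
      omega
  have hinj : Function.Injective (fun q : ℤ × ℤ => (2 * q.1 + a, 2 * q.2 + b)) := by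
    rintro ⟨x, y⟩ ⟨u, v⟩ h
    simp only [Prod.mk.injEq] at h ⊢
    omega
  rw [him, Set.ncard_image_of_injective _ hinj, Set.ncard_coe_finset, Finset.card_product,
    Int.card_Icc, Int.card_Icc]
  push_cast
  rw [Int.toNat_of_nonneg (by omega), Int.toNat_of_nonneg (by omega)]
  ring

lemma not_isMid_iff {p : ℤ × ℤ} : ¬ IsMid p ↔ HasParity 0 p ∨ HasParity 1 p := by
  simp only [IsMid, HasParity]
  omega

lemma ncard_isMid {n : ℕ} (hn : 1 ≤ n) :
    (({p ∈ hBox n | IsMid p} : Set (ℤ × ℤ)).ncard : ℤ) = 2 * n * (n - 1) := by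
  have h : ({p ∈ hBox n | IsMid p} : Set (ℤ × ℤ)) =
      {p ∈ hBox n | p.1 % 2 = 0 ∧ p.2 % 2 = 1} ∪ {p ∈ hBox n | p.1 % 2 = 1 ∧ p.2 % 2 = 0} := by
    ext p
    simp only [IsMid, Set.mem_ofPred_eq, Set.mem_union]
    grind
  rw [h, Set.ncard_union_eq ?_ ((finite_hBox n).subset (Set.sep_subset _ _))
    ((finite_hBox n).subset (Set.sep_subset _ _))]
  · push_cast
    rw [ncard_parity n (by simp) (by simp) hn, ncard_parity n (by simp) (by simp) hn]
    ring
  · rw [Set.disjoint_left]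
    intro p hp hp'
    simp only [Set.mem_ofPred_eq] at hp hp'
    omega

lemma mem_HNEset_of_hasParity_one {n : ℕ} {vt v1 v2 v3 p : ℤ × ℤ} (hp : HasParity 1 p) :
    p ∈ HNEset n vt v1 v2 v3 ↔ p ∈ hBox n := by
  simp only [HNEset, HasParity, dbl, Set.mem_sdiff, Set.mem_insert_iff, Set.mem_singleton_iff,
    Prod.ext_iff] at *
  grind

lemma dbl_mem_HNEset {n : ℕ} {vt v1 v2 v3 u : ℤ × ℤ} :
    dbl u ∈ HNEset n vt v1 v2 v3 ↔ u ∈ gBox n ∧ u ≠ v1 ∧ u ≠ v2 ∧ u ≠ v3 := by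
  simp only [HNEset, dbl, gBox, hBox, Set.mem_sdiff, Set.mem_insert_iff, Set.mem_singleton_iff,
    Set.mem_ofPred_eq, Prod.ext_iff, ne_eq]
  omega

lemma mem_HNEset_of_isMid {n : ℕ} {vt v1 v2 v3 p : ℤ × ℤ} (hp : IsMid p) :
    p ∈ HNEset n vt v1 v2 v3 ↔
      p ∈ hBox n ∧ p ≠ mid vt (vt.1 + 1, vt.2) ∧ p ≠ mid vt (vt.1, vt.2 + 1) := by
  simp only [HNEset, IsMid, dbl, mid, Set.mem_sdiff, Set.mem_insert_iff, Set.mem_singleton_iff,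
    Prod.ext_iff, ne_eq] at *
  grind

lemma gBox_ncard {n : ℕ} (hn : 1 ≤ n) : ((gBox n).ncard : ℤ) = n * n := by
  have h : ({p ∈ hBox n | p.1 % 2 = 0 ∧ p.2 % 2 = 0} : Set (ℤ × ℤ)) = dbl '' gBox n := by
    ext p
    constructor
    · rintro ⟨h1, h2⟩
      obtain ⟨u, rfl⟩ := exists_eq_dbl h2
      exact ⟨u, dbl_mem_hBox.1 h1, rfl⟩
    · rintro ⟨u, hu, rfl⟩
      exact ⟨dbl_mem_hBox.2 hu, hasParity_dbl u⟩
  rw [← Set.ncard_image_of_injective _ dbl_injective, ← h,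
    ncard_parity n (by simp) (by simp) hn]
  ring

lemma ncard_not_isMid_eq {n : ℕ} (hn : 1 ≤ n) {vt v1 v2 v3 : ℤ × ℤ} (hmt : vt ∈ gBox n)
    (hme : (vt.1 + 1, vt.2) ∈ gBox n) (hmn : (vt.1, vt.2 + 1) ∈ gBox n)
    (hm1 : v1 ∈ gBox n) (hm2 : v2 ∈ gBox n) (hm3 : v3 ∈ gBox n)
    (h12 : v1 ≠ v2) (h13 : v1 ≠ v3) (h23 : v2 ≠ v3) :
    ({p ∈ HNEset n vt v1 v2 v3 | ¬ IsMid p}).ncard =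
      ({p ∈ HNEset n vt v1 v2 v3 | IsMid p}).ncard := by
  have hB : {p ∈ HNEset n vt v1 v2 v3 | ¬ IsMid p} =
      (dbl '' (gBox n \ {v1, v2, v3})) ∪ {p ∈ hBox n | p.1 % 2 = 1 ∧ p.2 % 2 = 1} := by
    ext p
    simp only [Set.mem_ofPred_eq, not_isMid_iff, Set.mem_union]
    constructor
    · rintro ⟨h, h' | h'⟩
      · obtain ⟨u, rfl⟩ := exists_eq_dbl h'
        exact Or.inl ⟨u, by simpa [dbl_mem_HNEset] using h, rfl⟩
      · exact Or.inr ⟨(mem_HNEset_of_hasParity_one h').1 h, h'⟩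
    · rintro (⟨u, hu, rfl⟩ | ⟨h, h'⟩)
      · exact ⟨dbl_mem_HNEset.2 (by simpa using hu), Or.inl (hasParity_dbl u)⟩
      · exact ⟨(mem_HNEset_of_hasParity_one h').2 h, Or.inr h'⟩
  have hW : {p ∈ HNEset n vt v1 v2 v3 | IsMid p} = {p ∈ hBox n | IsMid p} \
      {mid vt (vt.1 + 1, vt.2), mid vt (vt.1, vt.2 + 1)} := by
    ext p
    simp only [Set.mem_ofPred_eq, Set.mem_sdiff, Set.mem_insert_iff, Set.mem_singleton_iff]
    constructor
    · rintro ⟨h, h'⟩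
      rw [mem_HNEset_of_isMid h'] at h
      tauto
    · rintro ⟨⟨h, h'⟩, h''⟩
      rw [mem_HNEset_of_isMid h']
      tauto
  have cB := Set.ncard_union_eq (s := dbl '' (gBox n \ {v1, v2, v3}))
    (t := {p ∈ hBox n | p.1 % 2 = 1 ∧ p.2 % 2 = 1}) (by
      rw [Set.disjoint_left]
      rintro p ⟨u, -, rfl⟩ ⟨-, hp⟩
      simp only [dbl] at hp
      omega) (((finite_gBox n).subset Set.sdiff_subset).image _)
    ((finite_hBox n).subset (Set.sep_subset _ _))
  rw [Set.ncard_image_of_injective _ dbl_injective] at cB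
  have c3 : ({v1, v2, v3} : Set (ℤ × ℤ)).ncard = 3 := by
    rw [Set.ncard_eq_three]
    exact ⟨v1, v2, v3, h12, h13, h23, rfl⟩
  have cV := Set.ncard_sdiff_add_ncard_of_subset (s := {v1, v2, v3}) (t := gBox n)
    (by simp [Set.insert_subset_iff, hm1, hm2, hm3]) (finite_gBox n)
  have c2 : ({mid vt (vt.1 + 1, vt.2), mid vt (vt.1, vt.2 + 1)} : Set (ℤ × ℤ)).ncard = 2 :=
    Set.ncard_pair (by simp [mid])
  have cW := Set.ncard_sdiff_add_ncard_of_subset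
    (s := {mid vt (vt.1 + 1, vt.2), mid vt (vt.1, vt.2 + 1)}) (t := {p ∈ hBox n | IsMid p}) (by
      rintro p (rfl | rfl)
      · exact ⟨mid_mem_hBox hmt hme, isMid_mid (by simp [lattice_adj])⟩
      · exact ⟨mid_mem_hBox hmt hmn, isMid_mid (by simp [lattice_adj])⟩)
    ((finite_hBox n).subset (Set.sep_subset _ _))
  rw [hB, hW]
  have k1 := ncard_isMid hn
  have k2 := gBox_ncard hn
  have k3 := ncard_parity n (a := 1) (b := 1) (by simp) (by simp) hn
  zify at *
  linarith

lemma ncard_edgeMids {n : ℕ} {T : SimpleGraph ↥(gBox n)} (hT : T ≤ lattice.induce (gBox n)) :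
    (edgeMids T).ncard = Nat.card T.edgeSet := by
  rw [← image_symMid_edgeSet, (symMid_injOn hT).ncard_image, Nat.card_coe_set_eq]

lemma isTree_of_ncard {n : ℕ} (hn : 1 ≤ n) {T : SimpleGraph ↥(gBox n)}
    (hT : T ≤ lattice.induce (gBox n)) (hac : T.IsAcyclic)
    (hcard : ((edgeMids T).ncard : ℤ) = n * n - 1) : T.IsTree := by
  classical
  have : Fintype ↥(gBox n) := Fintype.ofFinite _
  have : Nonempty ↥(gBox n) := ⟨⟨(0, 0), by simp [gBox]; omega⟩⟩
  obtain ⟨T', h1, -, h3⟩ :=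
    SimpleGraph.connected_top.exists_isTree_le_of_le_of_isAcyclic (le_top : T ≤ ⊤) hac
  have hle : T.edgeFinset ⊆ T'.edgeFinset := SimpleGraph.edgeFinset_mono h1
  have hc := h3.card_edgeFinset
  have hg := gBox_ncard hn
  rw [ncard_edgeMids hT, Nat.card_eq_fintype_card, ← SimpleGraph.edgeFinset_card] at hcard
  rw [← Nat.card_coe_set_eq, Nat.card_eq_fintype_card] at hg
  have : T = T' := SimpleGraph.edgeFinset_inj.1 (Finset.eq_of_subset_of_card_le hle (by omega))
  exact this ▸ h3

/-- The graph on the `n×n` grid whose edges are the ones whose midpoint is not matched by `μ` to a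
face. -/
def treeOf (n : ℕ) (X : Set (ℤ × ℤ)) (μ : ℤ × ℤ → ℤ × ℤ) : SimpleGraph ↥(gBox n) where
  Adj u v := lattice.Adj (u : ℤ × ℤ) v ∧ ∀ f ∈ X, HasParity 1 f → μ f ≠ mid u v
  symm := ⟨fun u v h => ⟨h.1.symm, mid_comm u v ▸ h.2⟩⟩
  loopless := ⟨fun _ h => h.1.ne rfl⟩

lemma treeOf_le (n : ℕ) (X : Set (ℤ × ℤ)) (μ : ℤ × ℤ → ℤ × ℤ) :
    treeOf n X μ ≤ lattice.induce (gBox n) := fun _ _ h => h.1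

lemma mem_edgeMids_treeOf {n : ℕ} {X : Set (ℤ × ℤ)} {μ : ℤ × ℤ → ℤ × ℤ} {d : ℤ × ℤ} :
    d ∈ edgeMids (treeOf n X μ) ↔
      (d ∈ hBox n ∧ IsMid d) ∧ ∀ f ∈ X, HasParity 1 f → μ f ≠ d := by
  constructor
  · rintro ⟨u, v, h, rfl⟩
    exact ⟨⟨mid_mem_hBox u.2 v.2, isMid_mid h.1⟩, h.2⟩
  · rintro ⟨⟨h1, h2⟩, h3⟩
    obtain ⟨u, hu, v, hv, h, rfl⟩ := exists_eq_mid h2 h1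
    exact ⟨⟨u, hu⟩, ⟨v, hv⟩, ⟨h, h3⟩, rfl⟩

lemma isAcyclic_treeOf {n : ℕ} {vt v1 v2 v3 : ℤ × ℤ} (hb1 : Boundary n v1)
    (hb2 : Boundary n v2) (hb3 : Boundary n v3) {μ : ℤ × ℤ → ℤ × ℤ}
    (hμ : IsMate (HNEset n vt v1 v2 v3) μ) : (treeOf n (HNEset n vt v1 v2 v3) μ).IsAcyclic := by
  by_contra hac
  obtain ⟨D, hne, hD, heven⟩ := exists_even_of_not_isAcyclic (treeOf_le n _ μ) hac
  obtain ⟨W, h1, h2, h3, h4, -⟩ := exists_enclosed_closed hb1 hb2 hb3 hμ hne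
    (fun d hd => (mem_edgeMids_treeOf.1 (hD d hd)).1.2) (Or.inl rfl) heven (P := hBox n)
    (fun d hd p hp hpd => by
      obtain ⟨u, v, h, rfl⟩ := hD d hd
      obtain ⟨x, rfl⟩ := exists_eq_dbl hp
      rcases (adj_dbl_mid_iff h.1).1 hpd with rfl | rfl
      exacts [dbl_mem_hBox.2 u.2, dbl_mem_hBox.2 v.2]) subset_rfl
    (fun q hq hq1 hqD => (mem_edgeMids_treeOf.1 (hD _ hqD)).2 q hq hq1 rfl)
  exact not_closed hb1 hb2 hb3 hμ (Or.inr rfl) h1 h2 h3 h4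

lemma isTree_treeOf {n : ℕ} (hn : 1 ≤ n) {vt v1 v2 v3 : ℤ × ℤ} (hb1 : Boundary n v1)
    (hb2 : Boundary n v2) (hb3 : Boundary n v3) {μ : ℤ × ℤ → ℤ × ℤ}
    (hμ : IsMate (HNEset n vt v1 v2 v3) μ) : (treeOf n (HNEset n vt v1 v2 v3) μ).IsTree := by
  refine isTree_of_ncard hn (treeOf_le n _ μ) (isAcyclic_treeOf hb1 hb2 hb3 hμ) ?_
  set F : Set (ℤ × ℤ) := {p ∈ hBox n | p.1 % 2 = 1 ∧ p.2 % 2 = 1}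
  have hFX : ∀ p ∈ F, p ∈ HNEset n vt v1 v2 v3 := fun p hp =>
    (mem_HNEset_of_hasParity_one hp.2).2 hp.1
  have he : edgeMids (treeOf n (HNEset n vt v1 v2 v3) μ) =
      {p ∈ hBox n | IsMid p} \ (μ '' F) := by
    ext d
    rw [mem_edgeMids_treeOf]
    simp only [Set.mem_sdiff, Set.mem_image, not_exists, not_and, Set.mem_ofPred_eq]
    refine and_congr_right fun _ => ⟨fun h f hf => h f (hFX f hf) hf.2, fun h f hf hp => ?_⟩
    exact h f ⟨hf.1, hp⟩
  have hinj : Set.InjOn μ F := fun a ha b hb hab => by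
    rw [← (hμ a (hFX a ha)).2.2, hab, (hμ b (hFX b hb)).2.2]
  have hsub : μ '' F ⊆ {p ∈ hBox n | IsMid p} := by
    rintro _ ⟨a, ha, rfl⟩
    have h := hμ a (hFX a ha)
    exact ⟨h.1.1, HasParity.isMid ha.2 h.2.1⟩
  have h1 := Set.ncard_sdiff_add_ncard_of_subset hsub
    ((finite_hBox n).subset (Set.sep_subset _ _))
  rw [hinj.ncard_image] at h1
  have h2 := ncard_isMid hn
  have h3 := ncard_parity n (a := 1) (b := 1) (by simp) (by simp) hn
  rw [he]
  zify at *
  linarith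

lemma deleteEdges_adj_iff {n : ℕ} {T : SimpleGraph ↥(gBox n)}
    (hT : T ≤ lattice.induce (gBox n)) {vt v1 v2 v3 : ℤ × ℤ} (hmt : vt ∈ gBox n)
    (hme : (vt.1 + 1, vt.2) ∈ gBox n) (hmn : (vt.1, vt.2 + 1) ∈ gBox n) {x y : ↥(gBox n)} :
    (T.deleteEdges {s(⟨vt, hmt⟩, ⟨_, hme⟩), s(⟨vt, hmt⟩, ⟨_, hmn⟩)}).Adj x y ↔
      T.Adj x y ∧ mid x y ∈ HNEset n vt v1 v2 v3 := by
  rw [SimpleGraph.deleteEdges_adj]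
  refine and_congr_right fun h => ?_
  have h' : lattice.Adj (x : ℤ × ℤ) y := hT h
  rw [mem_HNEset_of_isMid (isMid_mid h'), and_iff_right (mid_mem_hBox x.2 y.2)]
  obtain ⟨⟨a, b⟩, hx⟩ := x
  obtain ⟨⟨c, d⟩, hy⟩ := y
  simp only [Set.mem_insert_iff, Set.mem_singleton_iff, Sym2.eq_iff, Subtype.mk.injEq, mid,
    Prod.ext_iff, lattice_adj, ne_eq] at *
  rcases h' with ⟨rfl, rfl⟩ | ⟨rfl, rfl⟩ | ⟨rfl, rfl⟩ | ⟨rfl, rfl⟩ <;> omega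

lemma across_mid (u v : ℤ × ℤ) : across (mid u v) (dbl u) = dbl v := by
  simp only [across, mid, dbl, Prod.ext_iff]
  omega

lemma exists_eq_mid_of_adj {n : ℕ} {u d : ℤ × ℤ} (hd : d ∈ hBox n)
    (h : lattice.Adj (dbl u) d) : ∃ v ∈ gBox n, lattice.Adj u v ∧ d = mid u v := by
  obtain ⟨x, hx, y, hy, hxy, rfl⟩ := exists_eq_mid ((hasParity_dbl u).isMid h) hd
  rcases (adj_dbl_mid_iff hxy).1 h with rfl | rfl
  · exact ⟨y, hy, hxy, rfl⟩
  · exact ⟨x, hx, hxy.symm, mid_comm _ _⟩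

lemma not_hasParity_one_dbl (u : ℤ × ℤ) : ¬ HasParity 1 (dbl u) := by
  simp [HasParity, dbl]

lemma ne_of_interior_of_boundary {n : ℕ} {u v : ℤ × ℤ} (hu : Interior n u) (hv : Boundary n v) :
    u ≠ v := by
  rintro rfl
  obtain ⟨-, hv⟩ := hv
  simp only [Interior] at hu
  omega

lemma hasNETripod_treeOf {n : ℕ} {vt v1 v2 v3 : ℤ × ℤ} (hvt : Interior n vt)
    (hb1 : Boundary n v1) (hb2 : Boundary n v2) (hb3 : Boundary n v3)
    (hmt : vt ∈ gBox n) (hme : (vt.1 + 1, vt.2) ∈ gBox n) (hmn : (vt.1, vt.2 + 1) ∈ gBox n)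
    (hm1 : v1 ∈ gBox n) (hm2 : v2 ∈ gBox n) (hm3 : v3 ∈ gBox n)
    {μ : ℤ × ℤ → ℤ × ℤ} (hμ : IsMate (HNEset n vt v1 v2 v3) μ) :
    HasNETripod n (treeOf n (HNEset n vt v1 v2 v3) μ) ⟨vt, hmt⟩ ⟨v1, hm1⟩ ⟨v2, hm2⟩ ⟨v3, hm3⟩
      ⟨(vt.1 + 1, vt.2), hme⟩ ⟨(vt.1, vt.2 + 1), hmn⟩ := by
  set X := HNEset n vt v1 v2 v3 with hX
  have hadj : ∀ y : ↥(gBox n), lattice.Adj vt y → mid vt y ∉ X →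
      (treeOf n X μ).Adj ⟨vt, hmt⟩ y := fun y h1 h2 =>
    ⟨h1, fun f hf _ hfe => h2 (hfe ▸ (hμ f hf).1)⟩
  refine hasNETripod_of_reachable (isAcyclic_treeOf hb1 hb2 hb3 hμ) (hadj _ (by simp [lattice_adj])
    (by simp [hX, HNEset, mid]; grind)) (hadj _ (by simp [lattice_adj])
    (by simp [hX, HNEset, mid]; grind)) (by simp)
    (fun h => ne_of_interior_of_boundary hvt hb1 (congrArg Subtype.val h))
    (fun h => ne_of_interior_of_boundary hvt hb2 (congrArg Subtype.val h))
    (fun h => ne_of_interior_of_boundary hvt hb3 (congrArg Subtype.val h)) ?_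
  rintro x -
  by_contra hx
  set F := (treeOf n X μ).deleteEdges {s(⟨vt, hmt⟩, ⟨_, hme⟩), s(⟨vt, hmt⟩, ⟨_, hmn⟩)}
  let S : Set ↥(gBox n) := {x | ¬ ∃ r : ↥(gBox n), (r = ⟨v1, hm1⟩ ∨ r = ⟨v2, hm2⟩ ∨
    r = ⟨v3, hm3⟩) ∧ F.Reachable x r}
  have hS : ∀ y ∈ S, dbl y ∈ X := by
    intro y hy
    refine dbl_mem_HNEset.2 ⟨y.2, ?_, ?_, ?_⟩ <;> intro h <;>
      exact hy ⟨y, by simp [Subtype.ext_iff, h], .rfl⟩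
  refine not_closed hb1 hb2 hb3 hμ (Or.inl rfl) (P := (fun y : ↥(gBox n) => dbl y) '' S)
    ⟨_, x, hx, rfl⟩ ?_ ?_ ?_
  · rintro _ ⟨y, hy, rfl⟩
    exact hS y hy
  · rintro _ ⟨y, hy, rfl⟩
    exact hasParity_dbl _
  · rintro _ ⟨y, hy, rfl⟩
    obtain ⟨h1, h2, h3⟩ := hμ _ (hS y hy)
    obtain ⟨z, hz, hyz, he⟩ := exists_eq_mid_of_adj h1.1 h2
    refine ⟨⟨z, hz⟩, ?_, by simp only [he, across_mid]⟩
    rintro ⟨r, hr, hzr⟩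
    refine hy ⟨r, hr, .trans (SimpleGraph.Adj.reachable ?_) hzr⟩
    refine (deleteEdges_adj_iff (treeOf_le n _ μ) hmt hme hmn).2 ⟨⟨hyz, ?_⟩, he ▸ h1⟩
    intro f hf hf1 hfe
    refine not_hasParity_one_dbl y ?_
    rwa [← h3, he, ← hfe, (hμ f hf).2.2]

lemma not_isMid_of_adj {p q : ℤ × ℤ} (hp : IsMid p) (h : lattice.Adj p q) : ¬ IsMid q := by
  simp only [IsMid, lattice_adj] at *
  omega

lemma IsMate.mem_edgeMids_iff {n : ℕ} {X : Set (ℤ × ℤ)} {μ : ℤ × ℤ → ℤ × ℤ} (hμ : IsMate X μ)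
    (hX : X ⊆ hBox n) {w : ℤ × ℤ} (hw : w ∈ X) (hw' : IsMid w) :
    w ∈ edgeMids (treeOf n X μ) ↔ ¬ HasParity 1 (μ w) := by
  rw [mem_edgeMids_treeOf, and_iff_right ⟨hX hw, hw'⟩]
  constructor
  · exact fun h hp => h _ (hμ w hw).1 hp (hμ w hw).2.2
  · rintro h f hf hp rfl
    exact h ((hμ f hf).2.2.symm ▸ hp)

lemma IsMate.hasParity_of_treeOf_eq {n : ℕ} {X : Set (ℤ × ℤ)} {μ μ' : ℤ × ℤ → ℤ × ℤ}
    (hμ : IsMate X μ) (hμ' : IsMate X μ') (hX : X ⊆ hBox n) (h : treeOf n X μ = treeOf n X μ')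
    {w : ℤ × ℤ} (hw : w ∈ X) (hw' : IsMid w) {c : ℤ} (hc : c = 0 ∨ c = 1)
    (hp : HasParity c (μ' w)) : HasParity c (μ w) := by
  have h1 := hμ.mem_edgeMids_iff hX hw hw'
  have h2 := hμ'.mem_edgeMids_iff hX hw hw'
  rw [h, h2, not_iff_not] at h1
  have h3 := not_isMid_iff.1 (not_isMid_of_adj hw' (hμ w hw).2.1)
  rcases hc with rfl | rfl
  · refine h3.resolve_right fun h => ?_
    have := h1.2 h
    simp only [HasParity] at *
    omega
  · exact h1.1 hp

lemma IsMate.eq_of_treeOf_eq {n : ℕ} {vt v1 v2 v3 : ℤ × ℤ} (hb1 : Boundary n v1)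
    (hb2 : Boundary n v2) (hb3 : Boundary n v3) {μ μ' : ℤ × ℤ → ℤ × ℤ}
    (hμ : IsMate (HNEset n vt v1 v2 v3) μ) (hμ' : IsMate (HNEset n vt v1 v2 v3) μ')
    (h : treeOf n (HNEset n vt v1 v2 v3) μ = treeOf n (HNEset n vt v1 v2 v3) μ') :
    ∀ a ∈ HNEset n vt v1 v2 v3, μ a = μ' a := by
  have black : ∀ c : ℤ, c = 0 ∨ c = 1 → ∀ a ∈ HNEset n vt v1 v2 v3, HasParity c a →
      μ a = μ' a := by
    intro c hc a ha hac
    by_contra hne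
    refine not_closed hb1 hb2 hb3 hμ' hc
      (P := {p ∈ HNEset n vt v1 v2 v3 | HasParity c p ∧ μ p ≠ μ' p}) ⟨a, ha, hac, hne⟩
      (Set.sep_subset _ _) (fun p hp => hp.2.1) ?_
    rintro p ⟨hp, hpc, hpne⟩
    obtain ⟨k1, k2, k3⟩ := hμ' p hp
    have hmid := hpc.isMid k2
    obtain ⟨l1, l2, l3⟩ := hμ _ k1
    have hb : HasParity c (μ (μ' p)) :=
      hμ.hasParity_of_treeOf_eq hμ' Set.sdiff_subset h k1 hmid hc (k3.symm ▸ hpc)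
    rcases eq_or_eq_across hpc hb k2 l2.symm with he | he
    · rw [he] at l3
      exact absurd l3 hpne
    · rw [← he]
      refine ⟨l1, hb, fun hbe => ?_⟩
      have h1 := (hμ' _ l1).2.2
      rw [← hbe, l3, k3] at h1
      exact across_ne k2 (he ▸ h1.symm)
  intro a ha
  by_cases hmid : IsMid a
  · obtain ⟨k1, k2, k3⟩ := hμ a ha
    have hb : μ (μ a) = μ' (μ a) := by
      rcases not_isMid_iff.1 (not_isMid_of_adj hmid k2) with h0 | h0
      exacts [black 0 (Or.inl rfl) _ k1 h0, black 1 (Or.inr rfl) _ k1 h0]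
    have := (hμ' _ k1).2.2
    rwa [← hb, k3, eq_comm] at this
  · rcases not_isMid_iff.1 hmid with h0 | h0
    exacts [black 0 (Or.inl rfl) _ ha h0, black 1 (Or.inr rfl) _ ha h0]

lemma exists_isMate {X : Set (ℤ × ℤ)} {M : (lattice.induce X).Subgraph}
    (hM : M.IsPerfectMatching) :
    ∃ μ, IsMate X μ ∧ ∀ a b : ↥X, M.Adj a b ↔ μ a = b := by
  classical
  rw [SimpleGraph.Subgraph.isPerfectMatching_iff] at hM
  choose g hg hg' using hM
  have hgg : ∀ a, g (g a) = a := fun a => (hg' (g a) a (hg a).symm).symm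
  refine ⟨fun p => if hp : p ∈ X then g ⟨p, hp⟩ else p, fun a ha => ?_, fun a b => ?_⟩
  · have h : lattice.Adj a (g ⟨a, ha⟩ : ℤ × ℤ) := (hg ⟨a, ha⟩).adj_sub
    simp [ha, hgg, h]
  · simp only [a.2, dite_true, Subtype.coe_inj]
    exact ⟨fun h => (hg' a b h).symm, fun h => h ▸ hg a⟩

lemma IsMate.exists_isPerfectMatching {X : Set (ℤ × ℤ)} {μ : ℤ × ℤ → ℤ × ℤ}
    (hμ : IsMate X μ) : ∃ M : (lattice.induce X).Subgraph, M.IsPerfectMatching ∧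
      ∀ a b : ↥X, M.Adj a b ↔ μ a = b := by
  refine ⟨⟨Set.univ, fun a b => μ a = b, ?_, fun _ => trivial, ⟨?_⟩⟩, ?_, fun a b => Iff.rfl⟩
  · intro a b h
    change lattice.Adj (a : ℤ × ℤ) b
    exact h ▸ (hμ a a.2).2.1
  · intro a b h
    rw [← h]
    exact (hμ a a.2).2.2
  · rw [SimpleGraph.Subgraph.isPerfectMatching_iff]
    intro a
    exact ⟨⟨μ a, (hμ a a.2).1⟩, rfl, fun b h => Subtype.ext (Eq.symm h)⟩

lemma exists_injOn_next {E R P : Set (ℤ × ℤ)} {c : ℤ} (hpar : ∀ p ∈ P, HasParity c p)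
    (hPR : ∀ p ∈ P, p ∉ R)
    (h : ∀ p ∈ P, ∃ b ∈ R, Relation.ReflTransGen
      (fun p q => ∃ w ∈ E, lattice.Adj p w ∧ q = across w p) p b) :
    ∃ ω : ℤ × ℤ → ℤ × ℤ, (∀ p ∈ P, ω p ∈ E ∧ lattice.Adj p (ω p)) ∧ Set.InjOn ω P := by
  obtain ⟨d, ν, hν⟩ := exists_rank (fun p q => ∃ w ∈ E, lattice.Adj p w ∧ q = across w p) R
  have key : ∀ p, ∃ w, p ∈ P → w ∈ E ∧ lattice.Adj p w ∧ d (across w p) < d p := by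
    intro p
    by_cases hp : p ∈ P
    · obtain ⟨⟨w, h1, h2, h3⟩, h4⟩ := hν p (h p hp) (hPR p hp)
      exact ⟨w, fun _ => ⟨h1, h2, h3 ▸ h4⟩⟩
    · exact ⟨p, fun h => absurd h hp⟩
  choose ω hω using key
  refine ⟨ω, fun p hp => ⟨(hω p hp).1, (hω p hp).2.1⟩, fun p hp q hq hpq => ?_⟩
  obtain ⟨-, p1, p2⟩ := hω p hp
  obtain ⟨-, q1, q2⟩ := hω q hq
  rw [← hpq] at q1 q2
  rcases eq_or_eq_across (hpar p hp) (hpar q hq) p1 q1 with h1 | h1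
  · exact h1.symm
  · rcases eq_or_eq_across (hpar q hq) (hpar p hp) q1 p1 with h2 | h2
    · exact h2
    · rw [← h1] at p2
      rw [← h2] at q2
      omega

lemma exists_reachable_root {n : ℕ} {T : SimpleGraph ↥(gBox n)} (hT : T.IsTree)
    {t v1 v2 v3 e m : ↥(gBox n)} (hem : e ≠ m) (h1 : t ≠ v1) (h2 : t ≠ v2) (h3 : t ≠ v3)
    (h : HasNETripod n T t v1 v2 v3 e m) (x : ↥(gBox n)) :
    ∃ r, (r = v1 ∨ r = v2 ∨ r = v3) ∧ (T.deleteEdges {s(t, e), s(t, m)}).Reachable x r := by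
  obtain ⟨-, -, key⟩ := reachable_of_hasNETripod hem h1 h2 h3 h
  obtain ⟨w⟩ := hT.1.preconnected x t
  induction w with
  | nil => exact key _ (Or.inl rfl)
  | @cons a b c hab _ ih =>
    by_cases hF : s(a, b) ∈ ({s(c, e), s(c, m)} : Set (Sym2 ↥(gBox n)))
    · refine key a ?_
      simp only [Set.mem_insert_iff, Set.mem_singleton_iff, Sym2.eq_iff] at hF
      tauto
    · obtain ⟨r, hr, hbr⟩ := ih h1 h2 h3 h key
      exact ⟨r, hr, .trans (SimpleGraph.Adj.reachable
        ((SimpleGraph.deleteEdges_adj).2 ⟨hab, hF⟩)) hbr⟩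

lemma mem_hBox_of_adj {n : ℕ} {f w : ℤ × ℤ} (hf : HasParity 1 f) (hb : f ∈ hBox n)
    (h : lattice.Adj f w) : w ∈ hBox n := by
  simp only [HasParity, hBox, lattice_adj, Set.mem_ofPred_eq] at *
  omega

lemma even_card_common {p s : ℤ × ℤ} (hp : HasParity 0 p) (hs : HasParity 1 s)
    (B : Finset (ℤ × ℤ)) (hB : ∀ w, lattice.Adj s w → w ∈ B) :
    Even (B.filter (fun w => lattice.Adj p w ∧ lattice.Adj s w)).card := by
  rw [← ZMod.natCast_eq_zero_iff_even, Finset.card_eq_sum_ones, Nat.cast_sum]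
  refine Finset.sum_involution (fun w _ => (p.1 + s.1 - w.1, p.2 + s.2 - w.2))
    (fun _ _ => by simpa using zmod_two_add_self 1) ?_ ?_ ?_
  · intro w _ _ h
    simp only [Prod.ext_iff, HasParity] at *
    omega
  · intro w hw
    simp only [Finset.mem_filter] at hw ⊢
    have h1 : lattice.Adj s (p.1 + s.1 - w.1, p.2 + s.2 - w.2) := by
      have := hw.2.1
      simp only [lattice_adj] at *
      omega
    refine ⟨hB _ h1, ?_, h1⟩
    have := hw.2.2
    simp only [lattice_adj] at *
    omega
  · intro w _
    simp

lemma exists_even_boundary {n : ℕ} {S : Finset (ℤ × ℤ)} (hne : S.Nonempty)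
    (hpar : ∀ s ∈ S, HasParity 1 s) (hbox : ∀ s ∈ S, s ∈ hBox n) :
    ∃ D : Finset (ℤ × ℤ), D.Nonempty ∧
      (∀ d ∈ D, ∃ s ∈ S, lattice.Adj s d ∧ across d s ∉ S) ∧
      ∀ p, HasParity 0 p → Even (D.filter (fun d => lattice.Adj p d)).card := by
  classical
  set B := (finite_hBox n).toFinset with hB
  have hBS : ∀ s ∈ S, ∀ w, lattice.Adj s w → w ∈ B := fun s hs w h => by
    simpa [hB] using mem_hBox_of_adj (hpar s hs) (hbox s hs) h
  set D := B.filter (fun w => Odd (S.filter (fun s => lattice.Adj s w)).card) with hD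
  refine ⟨D, ?_, ?_, ?_⟩
  · obtain ⟨s, hs, hmax⟩ := S.exists_max_image (fun s => s.1) hne
    have hadj : lattice.Adj s (s.1 + 1, s.2) := by simp [lattice_adj]
    refine ⟨(s.1 + 1, s.2), Finset.mem_filter.2 ⟨hBS s hs _ hadj, ?_⟩⟩
    have : S.filter (fun r => lattice.Adj r (s.1 + 1, s.2)) = {s} := by
      ext r
      simp only [Finset.mem_filter, Finset.mem_singleton]
      constructor
      · rintro ⟨hr, h⟩
        have h1 := hmax r hr
        have h2 := hpar r hr
        have h3 := hpar s hs
        simp only [lattice_adj, HasParity, Prod.ext_iff] at *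
        omega
      · rintro rfl
        exact ⟨hs, hadj⟩
    simp [this]
  · intro d hd
    have h2 := (Finset.mem_filter.1 hd).2
    obtain ⟨s, hs⟩ := Finset.card_pos.1 h2.pos
    obtain ⟨hs, hsd⟩ := Finset.mem_filter.1 hs
    refine ⟨s, hs, hsd, fun hac => ?_⟩
    have : S.filter (fun r => lattice.Adj r d) = {s, across d s} := by
      ext r
      simp only [Finset.mem_filter, Finset.mem_singleton, Finset.mem_insert]
      constructor
      · rintro ⟨hr, h⟩
        exact eq_or_eq_across (hpar s hs) (hpar r hr) hsd h
      · rintro (rfl | rfl)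
        exacts [⟨hs, hsd⟩, ⟨hac, adj_across hsd⟩]
    rw [this, Finset.card_pair (across_ne hsd).symm] at h2
    exact absurd h2 (by decide)
  · intro p hp
    have h1 : ((D.filter (fun d => lattice.Adj p d)).card : ZMod 2) =
        ∑ w ∈ B.filter (fun w => lattice.Adj p w),
          ((S.filter (fun s => lattice.Adj s w)).card : ZMod 2) := by
      have : D.filter (fun d => lattice.Adj p d) = (B.filter (fun w => lattice.Adj p w)).filter
          (fun w => Odd (S.filter (fun s => lattice.Adj s w)).card) := by
        ext
        simp only [hD, Finset.mem_filter]
        tauto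
      rw [this, Finset.card_filter, Nat.cast_sum]
      refine Finset.sum_congr rfl fun w _ => ?_
      split_ifs with h
      · rw [Nat.cast_one, (ZMod.natCast_eq_one_iff_odd).2 h]
      · rw [Nat.cast_zero, eq_comm, ZMod.natCast_eq_zero_iff_even]
        exact Nat.not_odd_iff_even.1 h
    have h2 : ∑ w ∈ B.filter (fun w => lattice.Adj p w),
        (S.filter (fun s => lattice.Adj s w)).card =
        ∑ s ∈ S, (B.filter (fun w => lattice.Adj p w ∧ lattice.Adj s w)).card := by
      simp only [← Finset.filter_filter]
      exact Finset.sum_card_bipartiteAbove_eq_sum_card_bipartiteBelow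
        (fun w s => lattice.Adj s w)
    rw [← ZMod.natCast_eq_zero_iff_even, h1, ← Nat.cast_sum, h2,
      ZMod.natCast_eq_zero_iff_even]
    exact Finset.even_sum _ fun s hs => even_card_common hp (hpar s hs) B (hBS s hs)

lemma face_reaches_outside {n : ℕ} {T : SimpleGraph ↥(gBox n)}
    (hT : T ≤ lattice.induce (gBox n)) (hac : T.IsAcyclic) {f : ℤ × ℤ} (hf : HasParity 1 f) :
    ∃ b ∈ (hBox n)ᶜ, Relation.ReflTransGen
      (fun p q => ∃ w ∈ (edgeMids T)ᶜ, lattice.Adj p w ∧ q = across w p) f b := by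
  by_contra hcon
  set r : ℤ × ℤ → ℤ × ℤ → Prop :=
    fun p q => ∃ w ∈ (edgeMids T)ᶜ, lattice.Adj p w ∧ q = across w p
  have hfin : {g | HasParity 1 g ∧ ¬ ∃ b ∈ (hBox n)ᶜ, Relation.ReflTransGen r g b}.Finite := by
    refine (finite_hBox n).subset fun g hg => ?_
    by_contra h
    exact hg.2 ⟨g, h, .refl⟩
  have hbox : ∀ s ∈ hfin.toFinset, s ∈ hBox n := by
    intro g hg
    rw [Set.Finite.mem_toFinset] at hg
    by_contra h
    exact hg.2 ⟨g, h, .refl⟩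
  obtain ⟨D, h1, h2, h3⟩ := exists_even_boundary (n := n) (S := hfin.toFinset)
    ⟨f, by simpa using ⟨hf, by simpa using hcon⟩⟩
    (fun s hs => ((Set.Finite.mem_toFinset _).1 hs).1) hbox
  refine not_isAcyclic_of_even hT h1 (fun d hd => ?_) h3 hac
  obtain ⟨s, hs, hsd, hns⟩ := h2 d hd
  rw [Set.Finite.mem_toFinset] at hs hns
  by_contra hdT
  refine hns ⟨hs.1.across d, ?_⟩
  rintro ⟨b, hb, hsb⟩
  exact hs.2 ⟨b, hb, .head ⟨d, hdT, hsd, rfl⟩ hsb⟩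

lemma treeOf_congr {n : ℕ} {X : Set (ℤ × ℤ)} {μ μ' : ℤ × ℤ → ℤ × ℤ} (h : ∀ a ∈ X, μ a = μ' a) :
    treeOf n X μ = treeOf n X μ' := by
  ext u v
  simp only [treeOf]
  exact and_congr_right fun _ => forall₂_congr fun f hf => by rw [h f hf]

lemma isMate_of_bijOn {X : Set (ℤ × ℤ)} {φ : ℤ × ℤ → ℤ × ℤ}
    (hφ : Set.BijOn φ {p ∈ X | ¬ IsMid p} {p ∈ X | IsMid p})
    (hadj : ∀ p ∈ X, ¬ IsMid p → lattice.Adj p (φ p)) :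
    ∃ μ, IsMate X μ ∧ ∀ p, ¬ IsMid p → μ p = φ p := by
  classical
  refine ⟨fun p => if IsMid p then Function.invFunOn φ {p ∈ X | ¬ IsMid p} p else φ p,
    fun a ha => ?_, fun p hp => if_neg hp⟩
  by_cases hm : IsMid a
  · have h1 := Function.invFunOn_mem (hφ.surjOn ⟨ha, hm⟩)
    have h2 := Function.invFunOn_eq (hφ.surjOn ⟨ha, hm⟩)
    simp only [hm, if_true, h1.2, if_false]
    refine ⟨h1.1, ?_, h2⟩
    have h3 := hadj _ h1.1 h1.2
    rw [h2] at h3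
    exact h3.symm
  · have h1 := hφ.mapsTo ⟨ha, hm⟩
    simp only [hm, if_false, h1.2, if_true]
    exact ⟨h1.1, hadj a ha hm, hφ.injOn.leftInvOn_invFunOn ⟨ha, hm⟩⟩

lemma exists_vertex_next {n : ℕ} {vt v1 v2 v3 : ℤ × ℤ} (hvt : Interior n vt)
    (hb1 : Boundary n v1) (hb2 : Boundary n v2) (hb3 : Boundary n v3)
    (hmt : vt ∈ gBox n) (hme : (vt.1 + 1, vt.2) ∈ gBox n) (hmn : (vt.1, vt.2 + 1) ∈ gBox n)
    (hm1 : v1 ∈ gBox n) (hm2 : v2 ∈ gBox n) (hm3 : v3 ∈ gBox n)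
    {T : SimpleGraph ↥(gBox n)} (hT : T ≤ lattice.induce (gBox n)) (htree : T.IsTree)
    (htri : HasNETripod n T ⟨vt, hmt⟩ ⟨v1, hm1⟩ ⟨v2, hm2⟩ ⟨v3, hm3⟩
      ⟨(vt.1 + 1, vt.2), hme⟩ ⟨(vt.1, vt.2 + 1), hmn⟩) :
    ∃ ω : ℤ × ℤ → ℤ × ℤ, (∀ p ∈ {p ∈ HNEset n vt v1 v2 v3 | HasParity 0 p},
      ω p ∈ HNEset n vt v1 v2 v3 ∩ edgeMids T ∧ lattice.Adj p (ω p)) ∧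
      Set.InjOn ω {p ∈ HNEset n vt v1 v2 v3 | HasParity 0 p} := by
  refine exists_injOn_next (R := {dbl v1, dbl v2, dbl v3}) (fun p hp => hp.2) ?_ ?_
  · rintro p ⟨hp, hp'⟩
    obtain ⟨u, rfl⟩ := exists_eq_dbl hp'
    simpa [dbl_injective.eq_iff] using (dbl_mem_HNEset.1 hp).2
  · rintro p ⟨hp, hp'⟩
    obtain ⟨u, rfl⟩ := exists_eq_dbl hp'
    obtain ⟨r, hr, hur⟩ := exists_reachable_root htree (by simp)
      (fun h => ne_of_interior_of_boundary hvt hb1 (congrArg Subtype.val h))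
      (fun h => ne_of_interior_of_boundary hvt hb2 (congrArg Subtype.val h))
      (fun h => ne_of_interior_of_boundary hvt hb3 (congrArg Subtype.val h)) htri
      ⟨u, (dbl_mem_HNEset.1 hp).1⟩
    refine ⟨dbl r, by rcases hr with rfl | rfl | rfl <;> simp, ?_⟩
    rw [SimpleGraph.reachable_iff_reflTransGen] at hur
    refine hur.lift (fun x : ↥(gBox n) => dbl x) fun x y hxy => ?_
    rw [deleteEdges_adj_iff hT hmt hme hmn (v1 := v1) (v2 := v2) (v3 := v3)] at hxy
    exact ⟨mid x y, ⟨hxy.2, x, y, hxy.1, rfl⟩, adj_dbl_mid (hT hxy.1), (across_mid _ _).symm⟩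

lemma exists_face_next {n : ℕ} {T : SimpleGraph ↥(gBox n)}
    (hT : T ≤ lattice.induce (gBox n)) (hac : T.IsAcyclic) :
    ∃ ω : ℤ × ℤ → ℤ × ℤ, (∀ p ∈ {p ∈ hBox n | HasParity 1 p},
      ω p ∈ (edgeMids T)ᶜ ∧ lattice.Adj p (ω p)) ∧ Set.InjOn ω {p ∈ hBox n | HasParity 1 p} :=
  exists_injOn_next (R := (hBox n)ᶜ) (fun _ hp => hp.2) (fun _ hp h => h hp.1)
    fun _ hp => face_reaches_outside hT hac hp.2

lemma exists_isMate_of_isTree {n : ℕ} (hn : 1 ≤ n) {vt v1 v2 v3 : ℤ × ℤ} (hvt : Interior n vt)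
    (hb1 : Boundary n v1) (hb2 : Boundary n v2) (hb3 : Boundary n v3)
    (h12 : v1 ≠ v2) (h13 : v1 ≠ v3) (h23 : v2 ≠ v3)
    (hmt : vt ∈ gBox n) (hme : (vt.1 + 1, vt.2) ∈ gBox n) (hmn : (vt.1, vt.2 + 1) ∈ gBox n)
    (hm1 : v1 ∈ gBox n) (hm2 : v2 ∈ gBox n) (hm3 : v3 ∈ gBox n)
    {T : SimpleGraph ↥(gBox n)} (hT : T ≤ lattice.induce (gBox n)) (htree : T.IsTree)
    (htri : HasNETripod n T ⟨vt, hmt⟩ ⟨v1, hm1⟩ ⟨v2, hm2⟩ ⟨v3, hm3⟩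
      ⟨(vt.1 + 1, vt.2), hme⟩ ⟨(vt.1, vt.2 + 1), hmn⟩) :
    ∃ μ, IsMate (HNEset n vt v1 v2 v3) μ ∧ treeOf n (HNEset n vt v1 v2 v3) μ = T := by
  classical
  obtain ⟨ω0, h0, inj0⟩ := exists_vertex_next hvt hb1 hb2 hb3 hmt hme hmn hm1 hm2 hm3 hT htree htri
  obtain ⟨ω1, h1, inj1⟩ := exists_face_next hT htree.2
  obtain ⟨hTe, hTn, -⟩ := reachable_of_hasNETripod (by simp)
      (fun h => ne_of_interior_of_boundary hvt hb1 (congrArg Subtype.val h))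
      (fun h => ne_of_interior_of_boundary hvt hb2 (congrArg Subtype.val h))
      (fun h => ne_of_interior_of_boundary hvt hb3 (congrArg Subtype.val h)) htri
  set X := HNEset n vt v1 v2 v3 with hX
  have hXT : ∀ w, w ∈ hBox n → IsMid w → w ∉ X → w ∈ edgeMids T := by
    intro w hw hw' hwX
    rw [hX, mem_HNEset_of_isMid hw', and_iff_right hw, not_and_or, not_not, not_not] at hwX
    rcases hwX with rfl | rfl
    exacts [⟨_, _, hTe, rfl⟩, ⟨_, _, hTn, rfl⟩]
  have hface : ∀ f ∈ X, HasParity 1 f → ω1 f ∈ X ∧ ω1 f ∉ edgeMids T ∧ lattice.Adj f (ω1 f) := by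
    intro f hf hf1
    obtain ⟨k1, k2⟩ := h1 f ⟨hf.1, hf1⟩
    refine ⟨?_, k1, k2⟩
    by_contra h
    exact k1 (hXT _ (mem_hBox_of_adj hf1 hf.1 k2) (hf1.isMid k2) h)
  have hpar : ∀ {p : ℤ × ℤ}, HasParity 1 p → ¬ HasParity 0 p := by
    intro p h h'
    simp only [HasParity] at *
    omega
  set φ : ℤ × ℤ → ℤ × ℤ := fun p => if HasParity 0 p then ω0 p else ω1 p
  have φ0 : ∀ p, HasParity 0 p → φ p = ω0 p := fun p hp => if_pos hp
  have φ1 : ∀ p, HasParity 1 p → φ p = ω1 p := fun p hp => if_neg (hpar hp)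
  have hφX : ∀ p ∈ X, ¬ IsMid p → φ p ∈ X ∧ lattice.Adj p (φ p) := by
    intro p hp hm
    rcases not_isMid_iff.1 hm with h | h
    · rw [φ0 p h]
      exact ⟨(h0 p ⟨hp, h⟩).1.1, (h0 p ⟨hp, h⟩).2⟩
    · rw [φ1 p h]
      exact ⟨(hface p hp h).1, (hface p hp h).2.2⟩
  have hmaps : Set.MapsTo φ {p ∈ X | ¬ IsMid p} {p ∈ X | IsMid p} := by
    rintro p ⟨hp, hm⟩
    refine ⟨(hφX p hp hm).1, ?_⟩
    rcases not_isMid_iff.1 hm with h | h <;> exact h.isMid (hφX p hp hm).2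
  have hinj : Set.InjOn φ {p ∈ X | ¬ IsMid p} := by
    rintro p ⟨hp, hpm⟩ q ⟨hq, hqm⟩ hpq
    rcases not_isMid_iff.1 hpm with h | h <;> rcases not_isMid_iff.1 hqm with h' | h'
    · rw [φ0 p h, φ0 q h'] at hpq
      exact inj0 ⟨hp, h⟩ ⟨hq, h'⟩ hpq
    · rw [φ0 p h, φ1 q h'] at hpq
      exact absurd (hpq ▸ (h0 p ⟨hp, h⟩).1.2) (hface q hq h').2.1
    · rw [φ1 p h, φ0 q h'] at hpq
      exact absurd (hpq ▸ (h0 q ⟨hq, h'⟩).1.2) (hface p hp h).2.1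
    · rw [φ1 p h, φ1 q h'] at hpq
      exact inj1 ⟨hp.1, h⟩ ⟨hq.1, h'⟩ hpq
  have hfin : X.Finite := (finite_hBox n).subset Set.sdiff_subset
  have himg : φ '' {p ∈ X | ¬ IsMid p} = {p ∈ X | IsMid p} := by
    refine Set.eq_of_subset_of_ncard_le hmaps.image_subset ?_ (hfin.subset (Set.sep_subset _ _))
    rw [hinj.ncard_image]
    exact (ncard_not_isMid_eq hn hmt hme hmn hm1 hm2 hm3 h12 h13 h23).ge
  obtain ⟨μ, hμ, hμφ⟩ := isMate_of_bijOn ⟨hmaps, hinj, himg.ge⟩ (fun p hp hm => (hφX p hp hm).2)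
  have hμ1 : ∀ f, HasParity 1 f → μ f = ω1 f := fun f hf => by
    rw [hμφ f (not_isMid_iff.2 (Or.inr hf)), φ1 f hf]
  refine ⟨μ, hμ, ?_⟩
  ext u v
  constructor
  · rintro ⟨huv, hd⟩
    rw [← mid_mem_edgeMids hT huv]
    by_cases hmX : mid u v ∈ X
    · obtain ⟨b, ⟨hb, hbm⟩, hbe⟩ := himg.ge ⟨hmX, isMid_mid huv⟩
      rcases not_isMid_iff.1 hbm with h | h
      · rw [← hbe, φ0 b h]
        exact (h0 b ⟨hb, h⟩).1.2
      · exact absurd ((hμ1 b h).trans ((φ1 b h).symm.trans hbe)) (hd b hb h)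
    · exact hXT _ (mid_mem_hBox u.2 v.2) (isMid_mid huv) hmX
  · intro huv
    refine ⟨hT huv, fun f hf hf1 hfe => (hface f hf hf1).2.1 ?_⟩
    rw [← hμ1 f hf1, hfe]
    exact ⟨u, v, huv, rfl⟩


/-- Tripod Temperley bijection: the perfect matchings of `H_NE` are in bijection with
the spanning trees of the `n×n` grid graph `G` that have an NE-tripod at the interior
vertex `v_t` to the three distinct boundary vertices `v₁, v₂, v₃`; in particular the
number of perfect matchings of `H_NE` equals the number of such spanning trees. -/
theorem tripod_temperley_bijection (n : ℕ) (hn : 3 ≤ n) (vt v1 v2 v3 : ℤ × ℤ)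
    (hvt : Interior n vt)
    (hb1 : Boundary n v1) (hb2 : Boundary n v2) (hb3 : Boundary n v3)
    (h12 : v1 ≠ v2) (h13 : v1 ≠ v3) (h23 : v2 ≠ v3)
    (hmt : vt ∈ gBox n) (hme : ((vt.1 + 1, vt.2) : ℤ × ℤ) ∈ gBox n)
    (hmn : ((vt.1, vt.2 + 1) : ℤ × ℤ) ∈ gBox n)
    (hm1 : v1 ∈ gBox n) (hm2 : v2 ∈ gBox n) (hm3 : v3 ∈ gBox n) :
    Nonempty
      ({M : (lattice.induce (HNEset n vt v1 v2 v3)).Subgraph // M.IsPerfectMatching} ≃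
        {T : SimpleGraph ↥(gBox n) // T ≤ lattice.induce (gBox n) ∧ T.IsTree ∧
          HasNETripod n T ⟨vt, hmt⟩ ⟨v1, hm1⟩ ⟨v2, hm2⟩ ⟨v3, hm3⟩
            ⟨(vt.1 + 1, vt.2), hme⟩ ⟨(vt.1, vt.2 + 1), hmn⟩}) ∧
    Nat.card
        {M : (lattice.induce (HNEset n vt v1 v2 v3)).Subgraph // M.IsPerfectMatching} =
      Nat.card
        {T : SimpleGraph ↥(gBox n) // T ≤ lattice.induce (gBox n) ∧ T.IsTree ∧
          HasNETripod n T ⟨vt, hmt⟩ ⟨v1, hm1⟩ ⟨v2, hm2⟩ ⟨v3, hm3⟩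
            ⟨(vt.1 + 1, vt.2), hme⟩ ⟨(vt.1, vt.2 + 1), hmn⟩} := by
  have hlink := fun (M : {M : (lattice.induce (HNEset n vt v1 v2 v3)).Subgraph //
    M.IsPerfectMatching}) => exists_isMate M.2
  choose μ hμ hμM using hlink
  let Φ : {M : (lattice.induce (HNEset n vt v1 v2 v3)).Subgraph // M.IsPerfectMatching} →
      {T : SimpleGraph ↥(gBox n) // T ≤ lattice.induce (gBox n) ∧ T.IsTree ∧
        HasNETripod n T ⟨vt, hmt⟩ ⟨v1, hm1⟩ ⟨v2, hm2⟩ ⟨v3, hm3⟩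
          ⟨(vt.1 + 1, vt.2), hme⟩ ⟨(vt.1, vt.2 + 1), hmn⟩} := fun M =>
    ⟨treeOf n (HNEset n vt v1 v2 v3) (μ M), treeOf_le _ _ _,
      isTree_treeOf (by omega) hb1 hb2 hb3 (hμ M),
      hasNETripod_treeOf hvt hb1 hb2 hb3 hmt hme hmn hm1 hm2 hm3 (hμ M)⟩
  have hΦ : Function.Bijective Φ := by
    constructor
    · intro M M' h
      have heq := (hμ M).eq_of_treeOf_eq hb1 hb2 hb3 (hμ M') (congrArg Subtype.val h)
      refine Subtype.ext (SimpleGraph.Subgraph.ext ?_ ?_)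
      · rw [M.2.2.verts_eq_univ, M'.2.2.verts_eq_univ]
      · ext a b
        rw [hμM, hμM, heq a a.2]
    · rintro ⟨T, hT, htree, htri⟩
      obtain ⟨ν, hν, hνT⟩ := exists_isMate_of_isTree (by omega) hvt hb1 hb2 hb3 h12 h13 h23 hmt hme
        hmn hm1 hm2 hm3 hT htree htri
      obtain ⟨M, hM, hMν⟩ := hν.exists_isPerfectMatching
      refine ⟨⟨M, hM⟩, Subtype.ext ?_⟩
      exact (treeOf_congr fun a ha =>
        (hμM ⟨M, hM⟩ ⟨a, ha⟩ ⟨ν a, (hν a ha).1⟩).1 ((hMν _ _).2 rfl)).trans hνT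
  exact ⟨⟨Equiv.ofBijective Φ hΦ⟩, Nat.card_congr (Equiv.ofBijective Φ hΦ)⟩
end
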